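/- Let G be a bridgeless cubic graph and let J be a parity subgraph (join) of G. Then there exists a perfect matching M of G such that G \ (J ∪ M) is bipartite. -/

import Mathlib

namespace DartGraph

open Finset

variable {V : Type*} [DecidableEq V]

/-- A cubic multigraph with vertex set `S`: every vertex `v` carries the darts `(v, 0)`, `(v, 1)`,
`(v, 2)`, and the fixed-point-free involution `ε` matches each dart with the opposite dart of the
same edge. -/
structure IsCubic (S : Finset V) (ε : V × Fin 3 → V × Fin 3) : Prop where
  mem : ∀ d, d.1 ∈ S → (ε d).1 ∈ S
  inv : ∀ d, d.1 ∈ S → ε (ε d) = d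
  ne : ∀ d, d.1 ∈ S → ε d ≠ d

/-- The darts based in `X` whose opposite dart is based outside `X`. -/
def cut (ε : V × Fin 3 → V × Fin 3) (X : Finset V) : Finset (V × Fin 3) :=
  {d ∈ X ×ˢ univ | (ε d).1 ∉ X}

/-- No edge cut consists of a single edge. -/
def Bridgeless (S : Finset V) (ε : V × Fin 3 → V × Fin 3) : Prop :=
  ∀ X ⊆ S, #(cut ε X) ≠ 1

/-- A set of edges, given by its darts, with at most two edges at each vertex. -/
structure IsSparse (S : Finset V) (ε : V × Fin 3 → V × Fin 3) (L : V × Fin 3 → Prop) :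
    Prop where
  symm : ∀ d, d.1 ∈ S → L d → L (ε d)
  exists_not : ∀ v ∈ S, ∃ i, ¬ L (v, i)

/-- The darts `(v, μ v)` form a perfect matching, and `φ` is a proper 2-colouring of the edges in
`L` outside that matching. -/
structure Quells (S : Finset V) (ε : V × Fin 3 → V × Fin 3) (L : V × Fin 3 → Prop)
    (μ : V → Fin 3) (φ : V → Bool) : Prop where
  symm : ∀ d, d.1 ∈ S → μ d.1 = d.2 → μ (ε d).1 = (ε d).2
  color : ∀ d, d.1 ∈ S → L d → μ d.1 ≠ d.2 → φ d.1 ≠ φ (ε d).1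

/-- Some perfect matching containing the dart `e` leaves a bipartite part of `L`. -/
def Quellable (S : Finset V) (ε : V × Fin 3 → V × Fin 3) (L : V × Fin 3 → Prop)
    (e : V × Fin 3) : Prop :=
  ∃ μ φ, μ e.1 = e.2 ∧ Quells S ε L μ φ

variable {S X : Finset V} {ε : V × Fin 3 → V × Fin 3} {L : V × Fin 3 → Prop} {e : V × Fin 3}

@[simp]
theorem mem_cut {d : V × Fin 3} : d ∈ cut ε X ↔ d.1 ∈ X ∧ (ε d).1 ∉ X := by
  simp [cut]

theorem even_card_of_involution {α : Type*} [DecidableEq α] (s : Finset α) (g : α → α)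
    (hmem : ∀ a ∈ s, g a ∈ s) (hinv : ∀ a ∈ s, g (g a) = a) (hne : ∀ a ∈ s, g a ≠ a) :
    Even #s := by
  have h : ∑ _a ∈ s, (1 : ZMod 2) = 0 :=
    Finset.sum_involution (fun a _ => g a) (fun _ _ => by decide) (fun a ha _ => hne a ha)
      hmem hinv
  simpa [ZMod.natCast_eq_zero_iff_even] using h

theorem IsCubic.card_cut_sdiff (h : IsCubic S ε) (hX : X ⊆ S) :
    #(cut ε (S \ X)) = #(cut ε X) := by
  refine Finset.card_nbij' ε ε ?_ ?_ ?_ ?_ <;> intro d <;> have := h.mem d <;>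
    have := h.inv d <;> have := @hX d.1 <;> simp <;> grind

theorem IsCubic.even_card (h : IsCubic S ε) : Even #S := by
  have := even_card_of_involution (S ×ˢ (univ : Finset (Fin 3))) ε
    (fun d => by simpa using h.mem d) (fun d => by simpa using h.inv d)
    (fun d => by simpa using h.ne d)
  rw [card_product] at this
  simpa [Nat.even_mul, show ¬ Even 3 by decide] using this

theorem IsCubic.fst_ne (h : IsCubic S ε) (hb : Bridgeless S ε) {d : V × Fin 3} (hd : d.1 ∈ S) :
    (ε d).1 ≠ d.1 := by
  intro hloop
  have key : ∀ i j : Fin 3, i ≠ j → ∃ k, k ≠ i ∧ k ≠ j ∧ ∀ l, l = i ∨ l = j ∨ l = k := by decide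
  have hne : d.2 ≠ (ε d).2 := fun h' => h.ne d hd (Prod.ext hloop h'.symm)
  obtain ⟨k, hk1, hk2, hk⟩ := key _ _ hne
  have hinv := h.inv d hd
  apply hb {d.1} (by simpa using hd)
  rw [card_eq_one]
  refine ⟨(d.1, k), ?_⟩
  have hk3 := h.inv (d.1, k) hd
  have hk4 := h.ne (d.1, k) hd
  ext ⟨v, l⟩
  have := hk l
  have := hk (ε (d.1, k)).2
  simp only [mem_cut, mem_singleton]
  grind

theorem even_card_cut_filter [DecidablePred L] (h : IsCubic S ε) (hX : X ⊆ S)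
    (hL : IsSparse S ε L) (hL2 : ∀ d, d.1 ∈ S → L d → ∃ j ≠ d.2, L (d.1, j)) :
    Even #{d ∈ cut ε X | L d} := by
  have htotal : Even #{d ∈ X ×ˢ (univ : Finset (Fin 3)) | L d} := by
    rw [card_filter, sum_product]
    refine even_sum _ fun v hv => ?_
    rw [← card_filter]
    obtain ⟨k, hk⟩ := hL.exists_not v (hX hv)
    have : ({i : Fin 3 | L (v, i)} : Finset _) = ∅ ∨ ∃ i j, i ≠ j ∧
        ({i : Fin 3 | L (v, i)} : Finset _) = {i, j} := by
      by_cases hi : ∃ i, L (v, i)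
      · obtain ⟨i, hi⟩ := hi
        obtain ⟨j, hj, hj'⟩ := hL2 (v, i) (hX hv) hi
        have key : ∀ i j k l : Fin 3, i ≠ j → k ≠ i → k ≠ j → l = i ∨ l = j ∨ l = k := by decide
        right
        refine ⟨i, j, hj.symm, ?_⟩
        ext l
        have := key i j k l
        simp only [mem_filter, mem_univ, true_and, mem_insert, mem_singleton]
        grind
      · left
        ext; grind
    obtain h | ⟨i, j, hij, h⟩ := this <;> simp [*]
  have hinner : Even #{d ∈ X ×ˢ (univ : Finset (Fin 3)) | L d ∧ (ε d).1 ∈ X} := by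
    apply even_card_of_involution _ ε <;> simp only [mem_filter, mem_product, mem_univ] <;>
      intro d hd <;> have := h.mem d <;> have := h.inv d <;> have := h.ne d <;>
      have := hL.symm d <;> grind
  have hsum : #{d ∈ X ×ˢ (univ : Finset (Fin 3)) | L d} =
      #{d ∈ X ×ˢ (univ : Finset (Fin 3)) | L d ∧ (ε d).1 ∈ X} + #{d ∈ cut ε X | L d} := by
    rw [← card_union_of_disjoint]
    · congr 1; ext d; simp; grind
    · rw [disjoint_left]; intro d; simp; grind
  rw [hsum] at htotal
  exact (Nat.even_add.mp htotal).mp hinner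

theorem IsCubic.cut_sdiff (h : IsCubic S ε) (hX : X ⊆ S) :
    cut ε (S \ X) = (cut ε X).image ε := by
  ext d
  have := h.mem d
  have := h.inv d
  simp only [mem_cut, mem_sdiff, mem_image]
  constructor
  · intro hd
    exact ⟨ε d, by grind⟩
  · rintro ⟨c, hc, rfl⟩
    have := h.mem c
    have := h.inv c
    grind

theorem Quells.exists_color {μ : V → Fin 3} {φ : V → Bool} (h : Quells S ε L μ φ) (v : V)
    (b : Bool) : ∃ φ', Quells S ε L μ φ' ∧ φ' v = b := by
  by_cases hv : φ v = b
  · exact ⟨φ, h, hv⟩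
  · refine ⟨fun u => !φ u, ⟨h.symm, fun d hd hL hm => ?_⟩, ?_⟩
    · have := h.color d hd hL hm
      grind
    · cases hφ : φ v <;> cases b <;> simp_all

theorem Quells.glue (h : IsCubic S ε) (hL : IsSparse S ε L) {μ₁ μ₂ : V → Fin 3}
    {φ₁ φ₂ : V → Bool}
    (hin : ∀ d, d.1 ∈ X → (ε d).1 ∈ X → (μ₁ d.1 = d.2 → μ₁ (ε d).1 = (ε d).2) ∧
      (L d → μ₁ d.1 ≠ d.2 → φ₁ d.1 ≠ φ₁ (ε d).1))
    (hout : ∀ d, d.1 ∈ S \ X → (ε d).1 ∈ S \ X → (μ₂ d.1 = d.2 → μ₂ (ε d).1 = (ε d).2) ∧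
      (L d → μ₂ d.1 ≠ d.2 → φ₂ d.1 ≠ φ₂ (ε d).1))
    (hcross : ∀ d ∈ cut ε X, (μ₁ d.1 = d.2 ↔ μ₂ (ε d).1 = (ε d).2) ∧
      (L d → μ₁ d.1 ≠ d.2 → φ₁ d.1 ≠ φ₂ (ε d).1)) :
    Quells S ε L (fun v => if v ∈ X then μ₁ v else μ₂ v)
      (fun v => if v ∈ X then φ₁ v else φ₂ v) := by
  simp only [mem_cut, mem_sdiff] at hout hcross
  constructor <;> intro d hd <;> have := h.mem d hd <;> have := h.inv d hd <;>
    have := hL.symm d hd <;> have := hin d <;> have := hout d <;> have := hcross d <;>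
    have := hcross (ε d) <;> grind

/-- Every admissible choice of cubic multigraph, sparse edge set and dart on `S` is quellable. -/
def AllQuellable (S : Finset V) : Prop :=
  ∀ (ε : V × Fin 3 → V × Fin 3) (L : V × Fin 3 → Prop) (e : V × Fin 3),
    IsCubic S ε → Bridgeless S ε → IsSparse S ε L → e.1 ∈ S → Quellable S ε L e

theorem quellable_of_cut_eq_empty (ih : ∀ T : Finset V, #T < #S → AllQuellable T)
    (h : IsCubic S ε) (hb : Bridgeless S ε) (hL : IsSparse S ε L) (hX : X ⊆ S) (he : e.1 ∈ X)
    (hXS : (S \ X).Nonempty) (hcut : cut ε X = ∅) : Quellable S ε L e := by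
  have hcut' : cut ε (S \ X) = ∅ := by rw [h.cut_sdiff hX, hcut, image_empty]
  have key : ∀ Y ⊆ S, cut ε Y = ∅ → IsCubic Y ε ∧ Bridgeless Y ε ∧ IsSparse Y ε L := by
    intro Y hY hcY
    refine ⟨⟨fun d hd => ?_, fun d hd => h.inv d (hY hd), fun d hd => h.ne d (hY hd)⟩,
      fun Z hZ => hb Z (hZ.trans hY), fun d hd => hL.symm d (hY hd),
      fun v hv => hL.exists_not v (hY hv)⟩
    by_contra hd'
    exact notMem_empty d (hcY ▸ mem_cut.mpr ⟨hd, hd'⟩)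
  obtain ⟨v, hv⟩ := hXS
  have hlt : #X < #S := card_lt_card ⟨hX, fun hc => (mem_sdiff.mp hv).2 (hc (mem_sdiff.mp hv).1)⟩
  have hlt' : #(S \ X) < #S := by
    rw [card_sdiff_of_subset hX]
    have := card_pos.mpr ⟨_, he⟩
    omega
  obtain ⟨c₁, b₁, s₁⟩ := key X hX hcut
  obtain ⟨c₂, b₂, s₂⟩ := key _ sdiff_subset hcut'
  obtain ⟨μ₁, φ₁, he₁, q₁⟩ := ih X hlt ε L e c₁ b₁ s₁ he
  obtain ⟨μ₂, φ₂, -, q₂⟩ := ih _ hlt' ε L (v, 0) c₂ b₂ s₂ hv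
  refine ⟨_, _, ?_, Quells.glue (X := X) h hL (fun d hd _ => ⟨q₁.symm d hd, q₁.color d hd⟩)
    (fun d hd _ => ⟨q₂.symm d hd, q₂.color d hd⟩) (by simp [hcut])⟩
  simpa [he] using he₁

/-- Joins the darts `f` and `g` into a new edge. -/
def join (ε : V × Fin 3 → V × Fin 3) (f g : V × Fin 3) (d : V × Fin 3) : V × Fin 3 :=
  if d = f then g else if d = g then f else ε d

theorem join_cubic_bridgeless (h : IsCubic S ε) (hb : Bridgeless S ε) (hX : X ⊆ S)
    {f g : V × Fin 3} (hfg : f ≠ g) (hcut : cut ε X = {f, g}) :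
    IsCubic X (join ε f g) ∧ Bridgeless X (join ε f g) := by
  have hmem : ∀ d, (d.1 ∈ X ∧ (ε d).1 ∉ X) ↔ d = f ∨ d = g := fun d => by
    rw [← mem_cut, hcut]; simp
  have hc : IsCubic X (join ε f g) := by
    constructor <;> intro d hd <;> have := hmem d <;> have := hmem f <;> have := hmem g <;>
      have := h.inv d (hX hd) <;> have := h.ne d (hX hd) <;> grind [join]
  have key : ∀ Y ⊆ X, ¬ (f.1 ∈ Y ∧ g.1 ∈ Y) → cut (join ε f g) Y = cut ε Y := by
    intro Y hY hfgY
    ext d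
    simp only [mem_cut, join]
    grind
  refine ⟨hc, fun Y hY => ?_⟩
  by_cases hfgY : f.1 ∈ Y ∧ g.1 ∈ Y
  · rw [← hc.card_cut_sdiff hY, key _ sdiff_subset (by grind)]
    exact hb _ (sdiff_subset.trans hX)
  · rw [key Y hY hfgY]
    exact hb _ (hY.trans hX)

theorem quellable_of_card_cut_eq_two (ih : ∀ T : Finset V, #T < #S → AllQuellable T)
    (h : IsCubic S ε) (hb : Bridgeless S ε) (hL : IsSparse S ε L)
    (hL2 : ∀ d, d.1 ∈ S → L d → ∃ j ≠ d.2, L (d.1, j)) (hX : X ⊆ S) (he : e.1 ∈ X)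
    (hcard : #(cut ε X) = 2) : Quellable S ε L e := by
  classical
  obtain ⟨f, g, hfg, hcut⟩ := card_eq_two.mp hcard
  have hmem : ∀ d, (d.1 ∈ X ∧ (ε d).1 ∉ X) ↔ d = f ∨ d = g := fun d => by
    rw [← mem_cut, hcut]; simp
  have hf := (hmem f).mpr (.inl rfl)
  have hg := (hmem g).mpr (.inr rfl)
  have hcut' : cut ε (S \ X) = {ε f, ε g} := by
    rw [h.cut_sdiff hX, hcut, image_insert, image_singleton]
  have hfS := hX hf.1
  have hgS := hX hg.1
  have hfg' : ε f ≠ ε g := fun heq => hfg (by rw [← h.inv f hfS, heq, h.inv g hgS])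
  have hLfg : L f ↔ L g := by
    have := even_card_cut_filter h hX hL hL2
    rw [hcut, filter_insert, filter_singleton] at this
    by_cases L f <;> by_cases L g <;> simp_all
  have hmem' : ∀ d, (d.1 ∈ S \ X ∧ (ε d).1 ∉ S \ X) ↔ d = ε f ∨ d = ε g := fun d => by
    rw [← mem_cut, hcut']; simp
  have hlt : #X < #S := card_lt_card ⟨hX, fun hc => hf.2 (hc (h.mem f hfS))⟩
  have hlt' : #(S \ X) < #S := by
    rw [card_sdiff_of_subset hX]
    have := card_pos.mpr ⟨_, he⟩
    omega
  obtain ⟨c₁, b₁⟩ := join_cubic_bridgeless h hb hX hfg hcut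
  obtain ⟨c₂, b₂⟩ := join_cubic_bridgeless h hb sdiff_subset hfg' hcut'
  have hLf := hL.symm f hfS
  have hLg := hL.symm g hgS
  have hLf' := hL.symm (ε f) (h.mem f hfS)
  have hLg' := hL.symm (ε g) (h.mem g hgS)
  rw [h.inv f hfS] at hLf'
  rw [h.inv g hgS] at hLg'
  have s₁ : IsSparse X (join ε f g) L := by
    refine ⟨fun d hd hd' => ?_, fun v hv => hL.exists_not v (hX hv)⟩
    have := hL.symm d (hX hd)
    grind [join]
  have s₂ : IsSparse (S \ X) (join ε (ε f) (ε g)) L := by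
    refine ⟨fun d hd hd' => ?_, fun v hv => hL.exists_not v (sdiff_subset hv)⟩
    have := hL.symm d (sdiff_subset hd)
    grind [join]
  obtain ⟨μ₁, φ₁, he₁, q₁⟩ := ih X hlt _ L e c₁ b₁ s₁ he
  have hf' : (ε f).1 ∈ S \ X := mem_sdiff.mpr ⟨h.mem f hfS, hf.2⟩
  have hg' : (ε g).1 ∈ S \ X := mem_sdiff.mpr ⟨h.mem g hgS, hg.2⟩
  obtain ⟨i, hi⟩ : ∃ i, (i = (ε f).2 ↔ μ₁ f.1 = f.2) := by
    by_cases hm : μ₁ f.1 = f.2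
    · exact ⟨_, iff_of_true rfl hm⟩
    · obtain ⟨i, hi⟩ := exists_ne (ε f).2
      exact ⟨i, iff_of_false hi hm⟩
  obtain ⟨μ₂, φ, he₂, q⟩ := ih _ hlt' _ L ((ε f).1, i) c₂ b₂ s₂ hf'
  obtain ⟨φ₂, q₂, hφ₂⟩ := q.exists_color (ε f).1 (!φ₁ f.1)
  have join_left (a b : V × Fin 3) : join ε a b a = b := by simp [join]
  have join_right (a b : V × Fin 3) : join ε a b b = a := by grind [join]
  have join_ne (a b d : V × Fin 3) (ha : d ≠ a) (hb : d ≠ b) : join ε a b d = ε d := by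
    simp [join, ha, hb]
  refine ⟨_, _, ?_, Quells.glue (X := X) h hL (fun d hd hd' => ?_) (fun d hd hd' => ?_)
    (μ₁ := μ₁) (μ₂ := μ₂) (φ₁ := φ₁) (φ₂ := φ₂) ?_⟩
  · simpa [he] using he₁
  · have := join_ne f g d (by grind) (by grind)
    exact ⟨fun hm => by simpa [this] using q₁.symm d hd hm,
      fun hl hm => by simpa [this] using q₁.color d hd hl hm⟩
  · have := join_ne (ε f) (ε g) d (by grind) (by grind)
    exact ⟨fun hm => by simpa [this] using q₂.symm d hd hm,
      fun hl hm => by simpa [this] using q₂.color d hd hl hm⟩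
  · have m₁ := q₁.symm f hf.1
    have m₂ := q₁.symm g hg.1
    have m₃ := q₂.symm (ε f) hf'
    have m₄ := q₂.symm (ε g) hg'
    have l₁ := q₁.color f hf.1
    have l₂ := q₂.color (ε f) hf'
    simp only [join_left, join_right] at m₁ m₂ m₃ m₄ l₁ l₂
    intro d hd
    rw [hcut, mem_insert, mem_singleton] at hd
    have hff : μ₁ f.1 = f.2 ↔ μ₂ (ε f).1 = (ε f).2 := by rw [he₂, hi]
    have hgg : μ₁ g.1 = g.2 ↔ μ₂ (ε g).1 = (ε g).2 :=
      ⟨fun hm => m₃ (hff.mp (m₂ hm)), fun hm => m₁ (hff.mpr (m₄ hm))⟩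
    obtain hd | hd := hd <;> rw [hd]
    · exact ⟨hff, fun _ _ => by simp [hφ₂]⟩
    · refine ⟨hgg, fun hl hm => ?_⟩
      have n₁ := l₁ (hLfg.mpr hl) fun hm' => hm (m₁ hm')
      have n₂ := l₂ (hLf (hLfg.mpr hl)) fun hm' => hm (hgg.mpr (m₃ hm'))
      rw [hφ₂] at n₂
      intro heq
      rw [← heq] at n₂
      revert n₁ n₂
      cases φ₁ f.1 <;> cases φ₁ g.1 <;> simp

/-- Contracts the complement of `X`, whose boundary darts are `f 0`, `f 1`, `f 2`, to `r`. -/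
def contract (ε : V × Fin 3 → V × Fin 3) (X : Finset V) (r : V) (f : Fin 3 → V × Fin 3)
    (d : V × Fin 3) : V × Fin 3 :=
  if d.1 = r then f d.2 else if (ε d).1 ∈ X then ε d else
    (r, if d = f 0 then 0 else if d = f 1 then 1 else 2)

theorem contract_self {r : V} {f : Fin 3 → V × Fin 3} (i : Fin 3) :
    contract ε X r f (r, i) = f i := by
  simp [contract]

theorem contract_boundary {r : V} {f : Fin 3 → V × Fin 3} (hf : Function.Injective f)
    (hr : r ∉ X) {i : Fin 3} (hi : f i ∈ cut ε X) : contract ε X r f (f i) = (r, i) := by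
  rw [mem_cut] at hi
  have : (f i).1 ≠ r := by grind
  fin_cases i <;> simp_all [contract, hf.eq_iff]

theorem contract_of_mem {r : V} {f : Fin 3 → V × Fin 3} {d : V × Fin 3} (hd : d.1 ≠ r)
    (hd' : (ε d).1 ∈ X) : contract ε X r f d = ε d := by
  simp [contract, hd, hd']

theorem contract_cubic_bridgeless (h : IsCubic S ε) (hb : Bridgeless S ε) (hX : X ⊆ S) {r : V}
    (hr : r ∉ X) {f : Fin 3 → V × Fin 3} (hf : Function.Injective f)
    (hcut : ∀ d, d ∈ cut ε X ↔ ∃ i, f i = d) :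
    IsCubic (insert r X) (contract ε X r f) ∧ Bridgeless (insert r X) (contract ε X r f) := by
  have hfX : ∀ i, (f i).1 ∈ X ∧ (ε (f i)).1 ∉ X := fun i => by
    rw [← mem_cut, hcut]; exact ⟨i, rfl⟩
  have split : ∀ d : V × Fin 3, d.1 ∈ insert r X →
      (∃ i, d = (r, i)) ∨ (∃ i, d = f i) ∨ (d.1 ∈ X ∧ (ε d).1 ∈ X) := by
    intro d hd
    obtain hd | hd := mem_insert.mp hd
    · exact .inl ⟨d.2, Prod.ext hd rfl⟩
    · by_cases hd' : (ε d).1 ∈ X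
      · exact .inr (.inr ⟨hd, hd'⟩)
      · obtain ⟨i, hi⟩ := (hcut d).mp (mem_cut.mpr ⟨hd, hd'⟩)
        exact .inr (.inl ⟨i, hi.symm⟩)
  have cb : ∀ i, contract ε X r f (f i) = (r, i) := fun i =>
    contract_boundary hf hr ((hcut _).mpr ⟨i, rfl⟩)
  have ci : ∀ d : V × Fin 3, d.1 ∈ X → (ε d).1 ∈ X → contract ε X r f d = ε d :=
    fun d hd hd' => contract_of_mem (by grind) hd'
  have hc : IsCubic (insert r X) (contract ε X r f) := by
    constructor <;> intro d hd <;> obtain ⟨i, rfl⟩ | ⟨i, rfl⟩ | ⟨hd₁, hd₂⟩ := split d hd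
    · simp [contract_self, hfX]
    · simp [cb]
    · simp [ci d hd₁ hd₂, hd₂]
    · simp [contract_self, cb]
    · simp [contract_self, cb]
    · have := h.inv d (hX hd₁)
      rw [ci d hd₁ hd₂, ci _ hd₂ (by rwa [this]), this]
    · rw [contract_self]; have := hfX i; grind
    · rw [cb]; have := hfX i; grind
    · rw [ci d hd₁ hd₂]; exact h.ne d (hX hd₁)
  have key : ∀ Y ⊆ insert r X, r ∉ Y → cut (contract ε X r f) Y = cut ε Y := by
    intro Y hY hrY
    ext d
    simp only [mem_cut, and_congr_right_iff]
    intro hd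
    obtain ⟨i, rfl⟩ | ⟨i, rfl⟩ | ⟨hd₁, hd₂⟩ := split d (hY hd)
    · exact absurd hd hrY
    · have := hfX i
      rw [cb]
      grind
    · rw [ci d hd₁ hd₂]
  refine ⟨hc, fun Y hY => ?_⟩
  by_cases hrY : r ∈ Y
  · rw [← hc.card_cut_sdiff hY, key _ sdiff_subset (by grind)]
    exact hb _ (by grind)
  · rw [key Y hY hrY]
    exact hb _ (by grind)

theorem quellable_of_card_cut_eq_three (ih : ∀ T : Finset V, #T < #S → AllQuellable T)
    (h : IsCubic S ε) (hb : Bridgeless S ε) (hL : IsSparse S ε L)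
    (hL2 : ∀ d, d.1 ∈ S → L d → ∃ j ≠ d.2, L (d.1, j)) (hX : X ⊆ S) (he : e.1 ∈ X)
    (hX2 : 2 ≤ #X) (hXS : 2 ≤ #(S \ X)) (hcard : #(cut ε X) = 3) : Quellable S ε L e := by
  classical
  obtain ⟨f, hf, hcut⟩ : ∃ f : Fin 3 → V × Fin 3, Function.Injective f ∧
      ∀ d, d ∈ cut ε X ↔ ∃ i, f i = d := by
    let F := (cut ε X).equivFinOfCardEq hcard
    refine ⟨fun i => F.symm i, Subtype.val_injective.comp F.symm.injective, fun d => ?_⟩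
    exact ⟨fun hd => ⟨F ⟨d, hd⟩, by simp⟩, by rintro ⟨i, rfl⟩; exact (F.symm i).2⟩
  have hfX : ∀ i, (f i).1 ∈ X ∧ (ε (f i)).1 ∉ X := fun i => by
    rw [← mem_cut, hcut]; exact ⟨i, rfl⟩
  have hfS : ∀ i, (f i).1 ∈ S := fun i => hX (hfX i).1
  have hcut' : ∀ d, d ∈ cut ε (S \ X) ↔ ∃ i, ε (f i) = d := fun d => by
    rw [h.cut_sdiff hX, mem_image]
    constructor
    · rintro ⟨c, hc, rfl⟩
      obtain ⟨i, rfl⟩ := (hcut c).mp hc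
      exact ⟨i, rfl⟩
    · rintro ⟨i, rfl⟩
      exact ⟨f i, (hcut _).mpr ⟨i, rfl⟩, rfl⟩
  have hf' : Function.Injective fun i => ε (f i) := fun i j hij =>
    hf (by rw [← h.inv _ (hfS i), ← h.inv _ (hfS j)]; exact congrArg ε hij)
  obtain ⟨k, hk⟩ : ∃ k, ¬ L (f k) := by
    by_contra! hall
    have := even_card_cut_filter h hX hL hL2
    rw [filter_true_of_mem (by intro d hd; obtain ⟨i, rfl⟩ := (hcut d).mp hd; exact hall i),
      hcard] at this
    exact absurd this (by decide)
  have hLf : ∀ i, L (f i) ↔ L (ε (f i)) := fun i =>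
    ⟨hL.symm _ (hfS i), fun hl => by
      simpa [h.inv _ (hfS i)] using hL.symm _ (h.mem _ (hfS i)) hl⟩
  obtain ⟨r, hr⟩ := card_pos.mp (by omega : 0 < #(S \ X))
  obtain ⟨t, ht⟩ := card_pos.mp (by omega : 0 < #X)
  have hr' := mem_sdiff.mp hr
  have hsz : #(S \ X) = #S - #X := card_sdiff_of_subset hX
  have ht' : t ∉ S \ X := by simp [ht]
  obtain ⟨c₁, b₁⟩ := contract_cubic_bridgeless h hb hX hr'.2 hf hcut
  obtain ⟨c₂, b₂⟩ := contract_cubic_bridgeless h hb sdiff_subset ht' hf' hcut'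
  let K (v : V) (d : V × Fin 3) : Prop := if d.1 = v then L (f d.2) else L d
  have sparse : ∀ (Y : Finset V) (v : V) (g : Fin 3 → V × Fin 3), Y ⊆ S → v ∉ Y →
      Function.Injective g → (∀ d, d ∈ cut ε Y ↔ ∃ i, g i = d) → (∀ i, L (f i) ↔ L (g i)) →
      IsSparse (insert v Y) (contract ε Y v g) (K v) := by
    intro Y v g hY hv hg hcY hLg
    have hgY : ∀ i, (g i).1 ∈ Y := fun i => (mem_cut.mp ((hcY _).mpr ⟨i, rfl⟩)).1
    refine ⟨fun d hd hd' => ?_, fun u hu => ?_⟩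
    · by_cases hdv : d.1 = v
      · obtain ⟨u, i⟩ := d
        subst hdv
        rw [contract_self]
        grind
      · have hdY := (mem_insert.mp hd).resolve_left hdv
        simp only [K, hdv, if_false] at hd'
        by_cases hi : (ε d).1 ∈ Y
        · rw [contract_of_mem hdv hi]
          have := hL.symm d (hY hdY) hd'
          grind
        · obtain ⟨i, rfl⟩ := (hcY d).mp (mem_cut.mpr ⟨hdY, hi⟩)
          rw [contract_boundary hg hv ((hcY _).mpr ⟨i, rfl⟩)]
          simp [K, hLg, hd']
    · by_cases huv : u = v
      · exact ⟨k, by simp [K, huv, hk]⟩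
      · obtain ⟨i, hi⟩ := hL.exists_not u (hY ((mem_insert.mp hu).resolve_left huv))
        exact ⟨i, by simp [K, huv, hi]⟩
  obtain ⟨μ₁, φ₁, he₁, q₁⟩ := ih _ (by rw [card_insert_of_notMem hr'.2]; omega) _ (K r) e c₁ b₁
    (sparse X r f hX hr'.2 hf hcut fun i => Iff.rfl) (mem_insert_of_mem he)
  obtain ⟨μ₂, φ, he₂, q⟩ := ih _ (by rw [card_insert_of_notMem ht']; omega) _ (K t) (t, μ₁ r) c₂ b₂
    (sparse _ t _ sdiff_subset ht' hf' hcut' hLf) (mem_insert_self _ _)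
  obtain ⟨φ₂, q₂, hφ₂⟩ := q.exists_color t (!φ₁ r)
  have inner : ∀ (Y : Finset V) (v : V) (g : Fin 3 → V × Fin 3) (μ : V → Fin 3) (φ : V → Bool),
      v ∉ Y → Quells (insert v Y) (contract ε Y v g) (K v) μ φ → ∀ d, d.1 ∈ Y → (ε d).1 ∈ Y →
      (μ d.1 = d.2 → μ (ε d).1 = (ε d).2) ∧ (L d → μ d.1 ≠ d.2 → φ d.1 ≠ φ (ε d).1) := by
    intro Y v g μ φ hv q d hd hd'
    have hdv : d.1 ≠ v := by grind
    have hc : contract ε Y v g d = ε d := contract_of_mem hdv hd'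
    refine ⟨fun hm => ?_, fun hl hm => ?_⟩
    · simpa [hc] using q.symm d (mem_insert_of_mem hd) hm
    · simpa [hc] using q.color d (mem_insert_of_mem hd) (by simpa [K, hdv] using hl) hm
  have outer : ∀ (Y : Finset V) (v : V) (g : Fin 3 → V × Fin 3) (μ : V → Fin 3) (φ : V → Bool),
      v ∉ Y → Function.Injective g → (∀ d, d ∈ cut ε Y ↔ ∃ i, g i = d) →
      (∀ i, L (f i) ↔ L (g i)) → Quells (insert v Y) (contract ε Y v g) (K v) μ φ → ∀ i,
      (μ (g i).1 = (g i).2 ↔ μ v = i) ∧ (L (f i) → μ v ≠ i → φ v ≠ φ (g i).1) := by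
    intro Y v g μ φ hv hg hcY hLg q i
    have hgi := (hcY _).mpr ⟨i, rfl⟩
    have h₁ := contract_boundary hg hv hgi
    have h₂ : contract ε Y v g (v, i) = g i := contract_self i
    have h₃ := q.symm (v, i) (mem_insert_self _ _)
    have h₄ := q.symm (g i) (mem_insert_of_mem (mem_cut.mp hgi).1)
    have h₅ := q.color (v, i) (mem_insert_self _ _)
    rw [h₂] at h₃ h₅
    rw [h₁] at h₄
    refine ⟨⟨h₄, h₃⟩, fun hl hm => h₅ (by simpa [K] using hl) hm⟩
  refine ⟨_, _, ?_, Quells.glue (X := X) h hL (inner X r f μ₁ φ₁ hr'.2 q₁)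
    (inner _ t _ μ₂ φ₂ ht' q₂) ?_⟩
  · simpa [he] using he₁
  · intro d hd
    obtain ⟨i, rfl⟩ := (hcut d).mp hd
    have o₁ := outer X r f μ₁ φ₁ hr'.2 hf hcut (fun i => Iff.rfl) q₁ i
    have o₂ := outer _ t _ μ₂ φ₂ ht' hf' hcut' hLf q₂ i
    rw [he₂] at o₂
    refine ⟨o₁.1.trans o₂.1.symm, fun hl hm => ?_⟩
    have n₁ := o₁.2 hl fun hm' => hm (o₁.1.mpr hm')
    have n₂ := o₂.2 hl fun hm' => hm (o₁.1.mpr hm')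
    rw [hφ₂] at n₂
    intro heq
    rw [← heq] at n₂
    revert n₁ n₂
    cases φ₁ r <;> cases φ₁ (f i).1 <;> simp

theorem quellable_of_forall_reduced (h : IsCubic S ε) (hb : Bridgeless S ε) (he : e.1 ∈ S)
    (H : ∀ L, IsSparse S ε L → ¬ L e → (∀ d, d.1 ∈ S → L d → ∃ j ≠ d.2, L (d.1, j)) →
      Quellable S ε L e) (hL : IsSparse S ε L) : Quellable S ε L e := by
  classical
  have sub : ∀ (L : V × Fin 3 → Prop) (d : V × Fin 3), d.1 ∈ S → IsSparse S ε L →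
      IsSparse S ε fun c => L c ∧ c ≠ d ∧ c ≠ ε d := by
    intro L d hd hL
    refine ⟨fun c hc hLc => ⟨hL.symm c hc hLc.1, ?_, ?_⟩, fun v hv => ?_⟩
    · rintro rfl
      exact hLc.2.2 (h.inv c hc).symm
    · intro hcd
      exact hLc.2.1 (by rw [← h.inv c hc, hcd, h.inv d hd])
    · obtain ⟨i, hi⟩ := hL.exists_not v hv
      exact ⟨i, fun hc => hi hc.1⟩
  have main : ∀ (n : ℕ) (L : V × Fin 3 → Prop), #{d ∈ S ×ˢ (univ : Finset (Fin 3)) | L d} = n →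
      IsSparse S ε L → ¬ L e → Quellable S ε L e := by
    intro n
    induction n using Nat.strong_induction_on with
    | _ n ih =>
    intro L hn hL hLe
    by_cases hL2 : ∀ d, d.1 ∈ S → L d → ∃ j ≠ d.2, L (d.1, j)
    · exact H L hL hLe hL2
    push Not at hL2
    obtain ⟨d, hd, hLd, hleaf⟩ := hL2
    have hlt : #{c ∈ S ×ˢ (univ : Finset (Fin 3)) | L c ∧ c ≠ d ∧ c ≠ ε d} < n := by
      rw [← hn]
      refine card_lt_card ⟨fun c => by simp only [mem_filter]; tauto, fun hc => ?_⟩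
      have := @hc d (by simp [hd, hLd])
      simp at this
    obtain ⟨μ, φ, hμ, q⟩ := ih _ hlt _ (by congr!) (sub L d hd hL) (fun hc => hLe hc.1)
    have hne := h.fst_ne hb hd
    refine ⟨μ, Function.update φ d.1 (!φ (ε d).1), hμ, q.symm, fun c hc hLc hm => ?_⟩
    have honly : ∀ c, c.1 = d.1 → L c → c = d := by
      rintro ⟨v, j⟩ rfl hj
      by_contra hjd
      exact hleaf j (fun h' => hjd (Prod.ext rfl h')) hj
    by_cases h₁ : c = d
    · subst h₁
      simp [Function.update_of_ne hne]
    by_cases h₂ : c = ε d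
    · subst h₂
      simp [Function.update_of_ne hne, h.inv d hd]
    have h₃ : c.1 ≠ d.1 := fun h' => h₁ (honly c h' hLc)
    have h₄ : (ε c).1 ≠ d.1 := fun h' =>
      h₂ (by rw [← honly _ h' (hL.symm c hc hLc), h.inv c hc])
    rw [Function.update_of_ne h₃, Function.update_of_ne h₄]
    exact q.color c hc ⟨hLc, h₁, h₂⟩ hm
  obtain ⟨μ, φ, hμ, q⟩ := main _ _ rfl (sub L e he hL) (by simp)
  refine ⟨μ, φ, hμ, q.symm, fun d hd hLd hm => q.color d hd ⟨hLd, ?_, ?_⟩ hm⟩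
  · rintro rfl
    exact hm hμ
  · rintro rfl
    exact hm (q.symm e he hμ)

theorem card_cut_add_card_le {D : Finset (V × Fin 3)} (hD : ∀ d ∈ D, d.1 ∈ X ∧ (ε d).1 ∈ X) :
    #(cut ε X) + #D ≤ 3 * #X := by
  rw [← card_union_of_disjoint]
  · refine (card_le_card (t := X ×ˢ (univ : Finset (Fin 3))) fun d hd => ?_).trans
      (by simp [mul_comm])
    have := hD d
    simp only [mem_union, mem_cut] at hd
    simp
    tauto
  · rw [disjoint_left]
    intro d hd hd'
    exact (mem_cut.mp hd).2 (hD d hd').2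

/-- A bridgeless cubic multigraph all of whose edge cuts with at least two vertices on either side
have at least four edges. -/
structure Robust (S : Finset V) (ε : V × Fin 3 → V × Fin 3) : Prop extends IsCubic S ε where
  bridgeless : Bridgeless S ε
  four_le : ∀ X ⊆ S, 2 ≤ #X → 2 ≤ #(S \ X) → 4 ≤ #(cut ε X)

theorem Robust.fst_ne (h : Robust S ε) {d : V × Fin 3} (hd : d.1 ∈ S) : (ε d).1 ≠ d.1 :=
  h.toIsCubic.fst_ne h.bridgeless hd

theorem Robust.no_double_edge (h : Robust S ε) (hS : 5 ≤ #S) {c d : V × Fin 3} (hc : c.1 ∈ S)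
    (hcd : c ≠ d) (h₁ : c.1 = d.1) : (ε c).1 ≠ (ε d).1 := by
  intro h₂
  have hd : d.1 ∈ S := h₁ ▸ hc
  have n₁ := h.fst_ne hc
  have hsub : {c.1, (ε c).1} ⊆ S := by
    intro v hv
    have := h.mem c hc
    grind
  have hcard : #{c.1, (ε c).1} = 2 := card_pair n₁.symm
  have hinj : ε c ≠ ε d := fun h' => hcd (by rw [← h.inv c hc, h', h.inv d hd])
  have hD : #{c, d, ε c, ε d} = 4 := by
    rw [card_insert_of_notMem, card_insert_of_notMem, card_pair hinj] <;>
      simp only [mem_insert, mem_singleton] <;> grind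
  have h₃ := h.four_le _ hsub hcard.ge (by rw [card_sdiff_of_subset hsub]; omega)
  have h₄ := card_cut_add_card_le (X := {c.1, (ε c).1}) (ε := ε) (D := {c, d, ε c, ε d}) (by
    have := h.inv c hc
    have := h.inv d hd
    simp only [mem_insert, mem_singleton]
    grind)
  omega

theorem Robust.no_triangle (h : Robust S ε) (hS : 5 ≤ #S) {b c d : V × Fin 3} (hb : b.1 ∈ S)
    (hcd : c ≠ b) (h₁ : c.1 = b.1) (h₂ : (ε b).1 = d.1) : (ε d).1 ≠ (ε c).1 := by
  intro h₃
  have hc : c.1 ∈ S := h₁ ▸ hb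
  have hd : d.1 ∈ S := h₂ ▸ h.mem b hb
  have n₁ := h.fst_ne hb
  have n₂ := h.fst_ne hc
  have n₃ := h.fst_ne hd
  have i₁ := h.inv b hb
  have i₂ := h.inv c hc
  have i₃ := h.inv d hd
  have hsub : {b.1, d.1, (ε c).1} ⊆ S := by
    intro v hv
    have := h.mem c hc
    grind
  have hcard : #{b.1, d.1, (ε c).1} = 3 := by
    rw [card_eq_three]
    exact ⟨_, _, _, by grind, by grind, by grind, rfl⟩
  have hD : #{b, c, ε b, d, ε c, ε d} = 6 := by
    have : ε c ≠ ε d := by grind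
    rw [card_insert_of_notMem, card_insert_of_notMem, card_insert_of_notMem,
      card_insert_of_notMem, card_pair this] <;>
      simp only [mem_insert, mem_singleton] <;> grind
  have h₅ := h.four_le _ hsub (by omega) (by rw [card_sdiff_of_subset hsub]; omega)
  have h₄ := card_cut_add_card_le (X := {b.1, d.1, (ε c).1}) (ε := ε)
      (D := {b, c, ε b, d, ε c, ε d}) (by
    simp only [mem_insert, mem_singleton]
    grind)
  omega

theorem card_cut_join {f g : V × Fin 3} (hfg : f ≠ g) (hf : (ε f).1 ∉ X) (hg : (ε g).1 ∉ X) :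
    #(cut ε X) = #(cut (join ε f g) X) + 2 * if f.1 ∈ X ∧ g.1 ∈ X then 1 else 0 := by
  split_ifs with hX
  · rw [mul_one, ← card_pair hfg, ← card_union_of_disjoint]
    · congr 1
      ext d
      simp only [mem_cut, mem_union, mem_insert, mem_singleton, join]
      grind
    · rw [disjoint_right]
      simp only [mem_cut, mem_insert, mem_singleton, join]
      grind
  · rw [mul_zero, add_zero]
    congr 1
    ext d
    simp only [mem_cut, join]
    grind

/-- The edge joining `x` and `y` through the darts `(x, i₀)` and `(y, j₀)` can be reduced: neither
end has a loop, and no other edge joins `x` to `y`. -/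
structure IsReducible (S : Finset V) (ε : V × Fin 3 → V × Fin 3) (x y : V)
    (i₀ i₁ i₂ j₀ j₁ j₂ : Fin 3) : Prop where
  left_mem : x ∈ S
  right_mem : y ∈ S
  ne : x ≠ y
  left_ne : i₀ ≠ i₁ ∧ i₀ ≠ i₂ ∧ i₁ ≠ i₂
  right_ne : j₀ ≠ j₁ ∧ j₀ ≠ j₂ ∧ j₁ ≠ j₂
  mid : ε (x, i₀) = (y, j₀)
  left₁ : (ε (x, i₁)).1 ≠ x ∧ (ε (x, i₁)).1 ≠ y
  left₂ : (ε (x, i₂)).1 ≠ x ∧ (ε (x, i₂)).1 ≠ y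
  right₁ : (ε (y, j₁)).1 ≠ x ∧ (ε (y, j₁)).1 ≠ y
  right₂ : (ε (y, j₂)).1 ≠ x ∧ (ε (y, j₂)).1 ≠ y

/-- Deletes `x` and `y` and, for `k = 1, 2`, replaces the edges at the darts `(x, iₖ)` and
`(y, jₖ)` by a single edge joining their far ends. -/
def reduce (ε : V × Fin 3 → V × Fin 3) (x y : V) (i₁ i₂ j₁ j₂ : Fin 3) :
    V × Fin 3 → V × Fin 3 :=
  join (join ε (ε (x, i₁)) (ε (y, j₁))) (ε (x, i₂)) (ε (y, j₂))

theorem eq_or_eq_or_eq {i₀ i₁ i₂ : Fin 3} (h : i₀ ≠ i₁ ∧ i₀ ≠ i₂ ∧ i₁ ≠ i₂) (i : Fin 3) :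
    i = i₀ ∨ i = i₁ ∨ i = i₂ := by
  lia

section Reduce

variable {x y : V} {i₀ i₁ i₂ j₀ j₁ j₂ : Fin 3}

theorem mem_sdiff_pair {v : V} : v ∈ S \ {x, y} ↔ v ∈ S ∧ v ≠ x ∧ v ≠ y := by
  simp

theorem IsReducible.pairwise_ne (r : IsReducible S ε x y i₀ i₁ i₂ j₀ j₁ j₂) (h : IsCubic S ε) :
    ε (x, i₁) ≠ ε (x, i₂) ∧ ε (x, i₁) ≠ ε (y, j₁) ∧ ε (x, i₁) ≠ ε (y, j₂) ∧
      ε (x, i₂) ≠ ε (y, j₁) ∧ ε (x, i₂) ≠ ε (y, j₂) ∧ ε (y, j₁) ≠ ε (y, j₂) := by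
  have := h.inv (x, i₁) r.left_mem
  have := h.inv (x, i₂) r.left_mem
  have := h.inv (y, j₁) r.right_mem
  have := h.inv (y, j₂) r.right_mem
  have := r.ne
  have := r.left_ne
  have := r.right_ne
  grind

theorem IsReducible.reduce_apply (r : IsReducible S ε x y i₀ i₁ i₂ j₀ j₁ j₂) (h : IsCubic S ε) :
    reduce ε x y i₁ i₂ j₁ j₂ (ε (x, i₁)) = ε (y, j₁) ∧
    reduce ε x y i₁ i₂ j₁ j₂ (ε (y, j₁)) = ε (x, i₁) ∧
    reduce ε x y i₁ i₂ j₁ j₂ (ε (x, i₂)) = ε (y, j₂) ∧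
    reduce ε x y i₁ i₂ j₁ j₂ (ε (y, j₂)) = ε (x, i₂) := by
  obtain ⟨h₁, h₂, h₃, h₄, h₅, h₆⟩ := r.pairwise_ne h
  simp [reduce, join, h₁, h₃, h₆, h₂.symm, h₄.symm, h₅.symm]

theorem IsReducible.reduce_of_ne (r : IsReducible S ε x y i₀ i₁ i₂ j₀ j₁ j₂) (h : IsCubic S ε)
    {d : V × Fin 3} (hx : (ε d).1 ≠ x) (hy : (ε d).1 ≠ y) :
    reduce ε x y i₁ i₂ j₁ j₂ d = ε d := by
  have := h.inv (x, i₁) r.left_mem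
  have := h.inv (x, i₂) r.left_mem
  have := h.inv (y, j₁) r.right_mem
  have := h.inv (y, j₂) r.right_mem
  simp only [reduce, join]
  grind

theorem IsReducible.cases (r : IsReducible S ε x y i₀ i₁ i₂ j₀ j₁ j₂) (h : IsCubic S ε)
    {d : V × Fin 3} (hd : d.1 ∈ S \ {x, y}) :
    ((ε d).1 ≠ x ∧ (ε d).1 ≠ y) ∨ d = ε (x, i₁) ∨ d = ε (x, i₂) ∨ d = ε (y, j₁) ∨
      d = ε (y, j₂) := by
  rw [mem_sdiff_pair] at hd
  have h₁ := h.inv d hd.1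
  have h₂ := h.inv (x, i₀) r.left_mem
  have := r.mid
  by_cases hx : (ε d).1 = x
  · have := eq_or_eq_or_eq r.left_ne (ε d).2
    grind
  by_cases hy : (ε d).1 = y
  · have := eq_or_eq_or_eq r.right_ne (ε d).2
    grind
  exact .inl ⟨hx, hy⟩

theorem IsReducible.isCubic (r : IsReducible S ε x y i₀ i₁ i₂ j₀ j₁ j₂) (h : IsCubic S ε) :
    IsCubic (S \ {x, y}) (reduce ε x y i₁ i₂ j₁ j₂) := by
  obtain ⟨a₁, b₁, a₂, b₂⟩ := r.reduce_apply h
  obtain ⟨n₁, n₂, n₃, n₄, n₅, n₆⟩ := r.pairwise_ne h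
  have ha₁ := h.mem (x, i₁) r.left_mem
  have ha₂ := h.mem (x, i₂) r.left_mem
  have hb₁ := h.mem (y, j₁) r.right_mem
  have hb₂ := h.mem (y, j₂) r.right_mem
  refine ⟨fun d hd => ?_, fun d hd => ?_, fun d hd => ?_⟩ <;>
    obtain hd' | rfl | rfl | rfl | rfl := r.cases h hd <;>
    try simp only [a₁, b₁, a₂, b₂]
  · rw [r.reduce_of_ne h hd'.1 hd'.2, mem_sdiff_pair]
    exact ⟨h.mem d (sdiff_subset hd), hd'⟩
  · exact mem_sdiff_pair.mpr ⟨hb₁, r.right₁⟩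
  · exact mem_sdiff_pair.mpr ⟨hb₂, r.right₂⟩
  · exact mem_sdiff_pair.mpr ⟨ha₁, r.left₁⟩
  · exact mem_sdiff_pair.mpr ⟨ha₂, r.left₂⟩
  · have hinv := h.inv d (sdiff_subset hd)
    rw [mem_sdiff_pair] at hd
    rw [r.reduce_of_ne h hd'.1 hd'.2, r.reduce_of_ne h, hinv]
    all_goals rw [hinv]; tauto
  · rw [r.reduce_of_ne h hd'.1 hd'.2]
    exact h.ne d (sdiff_subset hd)
  · exact n₂.symm
  · exact n₅.symm
  · exact n₂
  · exact n₅

theorem IsReducible.card_cut (r : IsReducible S ε x y i₀ i₁ i₂ j₀ j₁ j₂) (h : IsCubic S ε)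
    (hX : X ⊆ S \ {x, y}) :
    #(cut ε X) = #(cut (reduce ε x y i₁ i₂ j₁ j₂) X) +
      2 * ((if (ε (x, i₁)).1 ∈ X ∧ (ε (y, j₁)).1 ∈ X then 1 else 0) +
        if (ε (x, i₂)).1 ∈ X ∧ (ε (y, j₂)).1 ∈ X then 1 else 0) := by
  obtain ⟨n₁, n₂, n₃, n₄, n₅, n₆⟩ := r.pairwise_ne h
  have hx : x ∉ X := fun h' => (mem_sdiff_pair.mp (hX h')).2.1 rfl
  have hy : y ∉ X := fun h' => (mem_sdiff_pair.mp (hX h')).2.2 rfl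
  have a₂ : join ε (ε (x, i₁)) (ε (y, j₁)) (ε (x, i₂)) = (x, i₂) := by
    simp [join, n₁.symm, n₄, h.inv (x, i₂) r.left_mem]
  have b₂ : join ε (ε (x, i₁)) (ε (y, j₁)) (ε (y, j₂)) = (y, j₂) := by
    simp [join, n₃.symm, n₆.symm, h.inv (y, j₂) r.right_mem]
  rw [card_cut_join n₂ (by rwa [h.inv (x, i₁) r.left_mem]) (by rwa [h.inv (y, j₁) r.right_mem]),
    card_cut_join n₅ (by rwa [a₂]) (by rwa [b₂]), reduce]
  ring

theorem IsReducible.isSparse (r : IsReducible S ε x y i₀ i₁ i₂ j₀ j₁ j₂) (h : IsCubic S ε)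
    (hL : IsSparse S ε L) : IsSparse (S \ {x, y}) (reduce ε x y i₁ i₂ j₁ j₂)
      fun d => L d ∧ (ε d).1 ≠ x ∧ (ε d).1 ≠ y := by
  refine ⟨fun d hd hLd => ?_, fun v hv => ?_⟩
  · rw [r.reduce_of_ne h hLd.2.1 hLd.2.2, h.inv d (sdiff_subset hd)]
    exact ⟨hL.symm d (sdiff_subset hd) hLd.1, (mem_sdiff_pair.mp hd).2⟩
  · obtain ⟨i, hi⟩ := hL.exists_not v (sdiff_subset hv)
    exact ⟨i, fun h' => hi h'.1⟩

theorem IsReducible.exists_quells (r : IsReducible S ε x y i₀ i₁ i₂ j₀ j₁ j₂) (h : IsCubic S ε)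
    (hL : IsSparse S ε L) {μ : V → Fin 3} {φ : V → Bool}
    (q : Quells (S \ {x, y}) (reduce ε x y i₁ i₂ j₁ j₂)
      (fun d => L d ∧ (ε d).1 ≠ x ∧ (ε d).1 ≠ y) μ φ)
    (h₂ : μ (ε (x, i₂)).1 ≠ (ε (x, i₂)).2) (cx cy : Bool)
    (hmatched : μ (ε (x, i₁)).1 = (ε (x, i₁)).2 → (L (x, i₀) → cx ≠ cy) ∧
      (L (x, i₂) → cx ≠ φ (ε (x, i₂)).1) ∧ (L (y, j₂) → cy ≠ φ (ε (y, j₂)).1))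
    (hfree : μ (ε (x, i₁)).1 ≠ (ε (x, i₁)).2 →
      (L (x, i₁) → cx ≠ φ (ε (x, i₁)).1) ∧ (L (x, i₂) → cx ≠ φ (ε (x, i₂)).1) ∧
      (L (y, j₁) → cy ≠ φ (ε (y, j₁)).1) ∧ (L (y, j₂) → cy ≠ φ (ε (y, j₂)).1)) :
    ∃ μ' φ', (∀ v, v ≠ x → v ≠ y → μ' v = μ v ∧ φ' v = φ v) ∧ φ' x = cx ∧ φ' y = cy ∧
      Quells S ε L μ' φ' := by
  obtain ⟨ra₁, rb₁, ra₂, rb₂⟩ := r.reduce_apply h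
  have hx := r.left_mem
  have hy := r.right_mem
  have hxy := r.ne
  have ma₁ := q.symm (ε (x, i₁)) (mem_sdiff_pair.mpr ⟨h.mem (x, i₁) hx, r.left₁⟩)
  have mb₁ := q.symm (ε (y, j₁)) (mem_sdiff_pair.mpr ⟨h.mem (y, j₁) hy, r.right₁⟩)
  have mb₂ := q.symm (ε (y, j₂)) (mem_sdiff_pair.mpr ⟨h.mem (y, j₂) hy, r.right₂⟩)
  rw [ra₁] at ma₁
  rw [rb₁] at mb₁
  rw [rb₂] at mb₂
  obtain ⟨p, s, hps⟩ : ∃ p s, (p = i₁ ∧ s = j₁ ∧ μ (ε (x, i₁)).1 = (ε (x, i₁)).2) ∨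
      (p = i₀ ∧ s = j₀ ∧ μ (ε (x, i₁)).1 ≠ (ε (x, i₁)).2) := by
    by_cases hm : μ (ε (x, i₁)).1 = (ε (x, i₁)).2
    · exact ⟨_, _, .inl ⟨rfl, rfl, hm⟩⟩
    · exact ⟨_, _, .inr ⟨rfl, rfl, hm⟩⟩
  have hi := r.left_ne
  have hj := r.right_ne
  obtain ⟨p₀, p₁, p₂, s₁, s₂⟩ : (p = i₀ ↔ s = j₀) ∧ (p = i₁ ↔ μ (ε (x, i₁)).1 = (ε (x, i₁)).2) ∧
      p ≠ i₂ ∧ (s = j₁ ↔ μ (ε (y, j₁)).1 = (ε (y, j₁)).2) ∧ s ≠ j₂ := by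
    grind
  have c₀ : L (x, i₀) → p ≠ i₀ → cx ≠ cy := by grind
  have c₁ : L (x, i₁) → p ≠ i₁ → cx ≠ φ (ε (x, i₁)).1 := by grind
  have c₂ : L (x, i₂) → cx ≠ φ (ε (x, i₂)).1 := by grind
  have d₁ : L (y, j₁) → s ≠ j₁ → cy ≠ φ (ε (y, j₁)).1 := by grind
  have d₂ : L (y, j₂) → cy ≠ φ (ε (y, j₂)).1 := by grind
  have h₃ : μ (ε (y, j₂)).1 ≠ (ε (y, j₂)).2 := fun hm => h₂ (mb₂ hm)
  clear hmatched hfree ma₁ mb₁ mb₂ hps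
  have hmid := r.mid
  have hmid' : ε (y, j₀) = (x, i₀) := by rw [← hmid, h.inv _ hx]
  have split : ∀ d : V × Fin 3, d.1 ∈ S → d = (x, i₀) ∨ d = (x, i₁) ∨ d = (x, i₂) ∨ d = (y, j₀) ∨
      d = (y, j₁) ∨ d = (y, j₂) ∨ d = ε (x, i₁) ∨ d = ε (x, i₂) ∨ d = ε (y, j₁) ∨
      d = ε (y, j₂) ∨ (d.1 ≠ x ∧ d.1 ≠ y ∧ (ε d).1 ≠ x ∧ (ε d).1 ≠ y) := by
    rintro ⟨v, i⟩ hd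
    by_cases hvx : v = x
    · obtain rfl | rfl | rfl := eq_or_eq_or_eq hi i <;> simp [hvx]
    by_cases hvy : v = y
    · obtain rfl | rfl | rfl := eq_or_eq_or_eq hj i <;> simp [hvy]
    obtain ⟨n₃, n₄⟩ | h' | h' | h' | h' :=
      r.cases h (d := (v, i)) (mem_sdiff_pair.mpr ⟨hd, hvx, hvy⟩)
    · simp [hvx, hvy, n₃, n₄]
    all_goals simp only [h', true_or, or_true]
  have vx₁ := h.inv (x, i₁) hx
  have vx₂ := h.inv (x, i₂) hx
  have vy₁ := h.inv (y, j₁) hy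
  have vy₂ := h.inv (y, j₂) hy
  have lx₁ := hL.symm (ε (x, i₁)) (h.mem (x, i₁) hx)
  have lx₂ := hL.symm (ε (x, i₂)) (h.mem (x, i₂) hx)
  have ly₁ := hL.symm (ε (y, j₁)) (h.mem (y, j₁) hy)
  have ly₂ := hL.symm (ε (y, j₂)) (h.mem (y, j₂) hy)
  have ly₀ := hL.symm (y, j₀) hy
  rw [vx₁] at lx₁
  rw [vx₂] at lx₂
  rw [vy₁] at ly₁
  rw [vy₂] at ly₂
  rw [hmid'] at ly₀
  obtain ⟨hx₁, hx₁'⟩ := r.left₁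
  obtain ⟨hx₂, hx₂'⟩ := r.left₂
  obtain ⟨hy₁, hy₁'⟩ := r.right₁
  obtain ⟨hy₂, hy₂'⟩ := r.right₂
  obtain ⟨μ', hμx, hμy, hμ⟩ : ∃ μ' : V → Fin 3, μ' x = p ∧ μ' y = s ∧
      ∀ v, v ≠ x → v ≠ y → μ' v = μ v :=
    ⟨fun v => if v = x then p else if v = y then s else μ v, by simp, by simp [hxy.symm],
      fun v h₁ h₂ => by simp [h₁, h₂]⟩
  obtain ⟨φ', hφx, hφy, hφ⟩ : ∃ φ' : V → Bool, φ' x = cx ∧ φ' y = cy ∧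
      ∀ v, v ≠ x → v ≠ y → φ' v = φ v :=
    ⟨fun v => if v = x then cx else if v = y then cy else φ v, by simp, by simp [hxy.symm],
      fun v h₁ h₂ => by simp [h₁, h₂]⟩
  refine ⟨μ', φ', fun v h₁ h₂ => ⟨hμ v h₁ h₂, hφ v h₁ h₂⟩, hφx, hφy, fun d hd => ?_,
    fun d hd => ?_⟩
  · obtain rfl | rfl | rfl | rfl | rfl | rfl | rfl | rfl | rfl | rfl | ⟨n₁, n₂, n₃, n₄⟩ :=
      split d hd
    · simpa only [hmid, hμx, hμy] using p₀.1
    · simpa only [hμx, hμ _ hx₁ hx₁'] using p₁.1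
    · exact fun hm => absurd (hμx.symm.trans hm) p₂
    · simpa only [hmid', hμx, hμy] using p₀.2
    · simpa only [hμy, hμ _ hy₁ hy₁'] using s₁.1
    · exact fun hm => absurd (hμy.symm.trans hm) s₂
    · simpa only [vx₁, hμx, hμ _ hx₁ hx₁'] using p₁.2
    · exact fun hm => absurd ((hμ _ hx₂ hx₂').symm.trans hm) h₂
    · simpa only [vy₁, hμy, hμ _ hy₁ hy₁'] using s₁.2
    · exact fun hm => absurd ((hμ _ hy₂ hy₂').symm.trans hm) h₃
    · have := q.symm d (mem_sdiff_pair.mpr ⟨hd, n₁, n₂⟩)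
      rwa [r.reduce_of_ne h n₃ n₄, ← hμ _ n₁ n₂, ← hμ _ n₃ n₄] at this
  · obtain rfl | rfl | rfl | rfl | rfl | rfl | rfl | rfl | rfl | rfl | ⟨n₁, n₂, n₃, n₄⟩ :=
      split d hd
    · simpa only [hmid, hμx, hφx, hφy] using c₀
    · simpa only [hμx, hφx, hφ _ hx₁ hx₁'] using c₁
    · simpa only [hφx, hφ _ hx₂ hx₂'] using fun hl _ => c₂ hl
    · simpa only [hmid', hμy, hφx, hφy] using
        fun hl hm => (c₀ (ly₀ hl) (mt p₀.1 hm)).symm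
    · simpa only [hμy, hφy, hφ _ hy₁ hy₁'] using d₁
    · simpa only [hφy, hφ _ hy₂ hy₂'] using fun hl _ => d₂ hl
    · simpa only [vx₁, hφx, hμ _ hx₁ hx₁', hφ _ hx₁ hx₁'] using
        fun hl hm => (c₁ (lx₁ hl) (mt p₁.1 hm)).symm
    · simpa only [vx₂, hφx, hφ _ hx₂ hx₂'] using fun hl _ => (c₂ (lx₂ hl)).symm
    · simpa only [vy₁, hφy, hμ _ hy₁ hy₁', hφ _ hy₁ hy₁'] using
        fun hl hm => (d₁ (ly₁ hl) (mt s₁.1 hm)).symm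
    · simpa only [vy₂, hφy, hφ _ hy₂ hy₂'] using fun hl _ => (d₂ (ly₂ hl)).symm
    · intro hl hm
      have := q.color d (mem_sdiff_pair.mpr ⟨hd, n₁, n₂⟩) ⟨hl, n₃, n₄⟩
      rw [r.reduce_of_ne h n₃ n₄, ← hμ _ n₁ n₂, ← hφ _ n₁ n₂, ← hφ _ n₃ n₄] at this
      exact this hm

end Reduce

theorem Robust.bridgeless_of_card_cut (h : Robust S ε) {T : Finset V}
    {ε' : V × Fin 3 → V × Fin 3} (h' : IsCubic T ε') (hT : T ⊆ S) (hST : 2 ≤ #(S \ T))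
    (N : Finset V → ℕ) (hN : ∀ X ⊆ T, #(cut ε X) = #(cut ε' X) + 2 * N X)
    (hN2 : ∀ X ⊆ T, N X ≠ 0 → 2 ≤ #X) (hN3 : ∀ X ⊆ T, N X + N (T \ X) ≤ 3) :
    Bridgeless T ε' := by
  intro X hX hcut
  have key : ∀ X ⊆ T, #(cut ε' X) = 1 → 2 ≤ N X := by
    intro X hX hcut
    have h₁ := hN X hX
    have h₂ := h.bridgeless X (hX.trans hT)
    have h₃ := h.four_le X (hX.trans hT)
    have h₄ := hN2 X hX
    have h₅ : #(S \ T) ≤ #(S \ X) := card_le_card (sdiff_subset_sdiff subset_rfl hX)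
    by_contra! hlt
    have h₆ : N X ≠ 0 := by rintro h₆; simp [h₆, hcut] at h₁; exact h₂ h₁
    omega
  have h₁ := key X hX hcut
  have h₂ := key _ sdiff_subset ((h'.card_cut_sdiff hX).trans hcut)
  have := hN3 X hX
  omega

theorem Robust.quellable_of_card_eq_two (h : Robust S ε) (he : e.1 ∈ S) (hS : #S = 2) :
    Quellable S ε L e := by
  have hne := h.fst_ne he
  have hS' : {e.1, (ε e).1} = S := by
    refine eq_of_subset_of_card_le (fun v hv => ?_) (by rw [hS, card_pair hne.symm])
    have := h.mem e he
    grind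
  have hmem : ∀ v ∈ S, v = e.1 ∨ v = (ε e).1 := fun v hv => by simpa [← hS'] using hv
  refine ⟨fun v => if v = e.1 then e.2 else (ε e).2, fun v => decide (v = e.1), by simp,
    fun d hd hm => ?_, fun d hd _ _ => ?_⟩
  · have hi := h.inv e he
    obtain rfl | rfl : d = e ∨ d = ε e := by
      obtain hv | hv := hmem _ hd
      · exact .inl (Prod.ext hv (by simpa [hv] using hm.symm))
      · exact .inr (Prod.ext hv (by simpa [hv, hne] using hm.symm))
    · simp [hne]
    · simp [hi]
  · have h₁ := hmem _ hd
    have h₂ := hmem _ (h.mem d hd)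
    have h₃ := h.fst_ne hd
    rw [Ne, decide_eq_decide]
    grind

theorem eq_or_eq_of_four_le_card_cut (h : IsCubic S ε) (hX : X ⊆ S) (hcard : #X = 2)
    (hcut : 4 ≤ #(cut ε X)) {d : V × Fin 3} (he : e.1 ∈ X) (he' : (ε e).1 ∈ X) (hd : d.1 ∈ X)
    (hd' : (ε d).1 ∈ X) : d = e ∨ d = ε e := by
  by_contra! hne
  have hee := h.ne e (hX he)
  have hD : #{d, e, ε e} = 3 := card_eq_three.mpr ⟨_, _, _, hne.1, hne.2, hee.symm, rfl⟩
  have := card_cut_add_card_le (X := X) (ε := ε) (D := {d, e, ε e}) (by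
    have := h.inv e (hX he)
    simp only [mem_insert, mem_singleton]
    grind)
  omega

theorem Robust.quellable_of_card_eq_four (h : Robust S ε) (he : e.1 ∈ S) (hS : #S = 4) :
    Quellable S ε L e := by
  have hne := h.fst_ne he
  have heS := h.mem e he
  obtain ⟨X, hXdef⟩ : ∃ X : Finset V, X = {e.1, (ε e).1} := ⟨_, rfl⟩
  have hX : X ⊆ S := by grind
  have hX2 : #X = 2 := hXdef ▸ card_pair hne.symm
  have hY2 : #(S \ X) = 2 := by rw [card_sdiff_of_subset hX]; omega
  have hcX := h.four_le X hX hX2.ge hY2.ge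
  have hcY := h.card_cut_sdiff hX
  obtain ⟨f, hf, hf'⟩ : ∃ f : V × Fin 3, f.1 ∈ S \ X ∧ (ε f).1 ∈ S \ X := by
    by_contra! hall
    have hsub : (S \ X) ×ˢ (univ : Finset (Fin 3)) ⊆ cut ε (S \ X) := by
      rintro d hd
      have hd' := (mem_product.mp hd).1
      exact mem_cut.mpr ⟨hd', hall d hd'⟩
    have h₁ := card_le_card hsub
    have h₂ := card_cut_add_card_le (X := X) (ε := ε) (D := {e, ε e}) (by
      have := h.inv e he
      simp only [mem_insert, mem_singleton]
      grind)
    rw [card_pair (h.ne e he).symm] at h₂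
    simp [hY2] at h₁
    omega
  have heX : e.1 ∈ X := by simp [hXdef]
  have heX' : (ε e).1 ∈ X := by simp [hXdef]
  have kX : ∀ d : V × Fin 3, d.1 ∈ X → (ε d).1 ∈ X → d = e ∨ d = ε e := fun d =>
    eq_or_eq_of_four_le_card_cut h.toIsCubic hX hX2 hcX heX heX'
  have kY : ∀ d : V × Fin 3, d.1 ∈ S \ X → (ε d).1 ∈ S \ X → d = f ∨ d = ε f := fun d =>
    eq_or_eq_of_four_le_card_cut h.toIsCubic sdiff_subset hY2 (by omega) hf hf'
  have hfS := sdiff_subset hf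
  have hfne := h.fst_ne hfS
  have hY : {f.1, (ε f).1} = S \ X := by
    refine eq_of_subset_of_card_le (fun v hv => ?_) (by rw [hY2, card_pair hfne.symm])
    grind
  have hmem : ∀ v ∈ S, v = e.1 ∨ v = (ε e).1 ∨ v = f.1 ∨ v = (ε f).1 := fun v hv => by
    by_cases hvX : v ∈ X
    · rw [hXdef] at hvX
      grind
    · have : v ∈ S \ X := mem_sdiff.mpr ⟨hv, hvX⟩
      rw [← hY] at this
      grind
  have n₁ : f.1 ≠ e.1 := fun h' => (mem_sdiff.mp hf).2 (h' ▸ heX)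
  have n₂ : f.1 ≠ (ε e).1 := fun h' => (mem_sdiff.mp hf).2 (h' ▸ heX')
  have n₃ : (ε f).1 ≠ e.1 := fun h' => (mem_sdiff.mp hf').2 (h' ▸ heX)
  have n₄ : (ε f).1 ≠ (ε e).1 := fun h' => (mem_sdiff.mp hf').2 (h' ▸ heX')
  obtain ⟨μ, m₁, m₂, m₃, m₄⟩ : ∃ μ : V → Fin 3, μ e.1 = e.2 ∧ μ (ε e).1 = (ε e).2 ∧
      μ f.1 = f.2 ∧ μ (ε f).1 = (ε f).2 :=
    ⟨fun v => if v = e.1 then e.2 else if v = (ε e).1 then (ε e).2 else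
      if v = f.1 then f.2 else (ε f).2, by simp, by simp [hne], by simp [n₁, n₂],
      by simp [n₃, n₄, hfne]⟩
  refine ⟨μ, fun v => decide (v ∈ X), m₁, fun d hd hm => ?_, fun d hd _ hm => ?_⟩
  · have i₁ := h.inv e he
    have i₂ := h.inv f hfS
    obtain hv | hv | hv | hv := hmem _ hd <;> rw [hv] at hm
    · rwa [show d = e from Prod.ext hv (hm.symm.trans m₁)]
    · rwa [show d = ε e from Prod.ext hv (hm.symm.trans m₂), i₁]
    · rwa [show d = f from Prod.ext hv (hm.symm.trans m₃)]
    · rwa [show d = ε f from Prod.ext hv (hm.symm.trans m₄), i₂]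
  · rw [Ne, decide_eq_decide]
    intro hiff
    by_cases hdX : d.1 ∈ X
    · obtain rfl | rfl := kX d hdX (hiff.mp hdX)
      · exact hm m₁
      · exact hm m₂
    · obtain rfl | rfl := kY d (mem_sdiff.mpr ⟨hd, hdX⟩)
        (mem_sdiff.mpr ⟨h.mem d hd, fun h' => hdX (hiff.mpr h')⟩)
      · exact hm m₃
      · exact hm m₄

section Step

variable {x y : V} {i₀ i₁ i₂ j₀ j₁ j₂ : Fin 3}

theorem exists_third {i j : Fin 3} (h : i ≠ j) : ∃ k, i ≠ k ∧ j ≠ k := by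
  revert h; revert i j; decide

theorem Robust.isReducible (h : Robust S ε) (hS : 5 ≤ #S) (hx : x ∈ S)
    (hmid : ε (x, i₀) = (y, j₀)) (hi : i₀ ≠ i₁ ∧ i₀ ≠ i₂ ∧ i₁ ≠ i₂)
    (hj : j₀ ≠ j₁ ∧ j₀ ≠ j₂ ∧ j₁ ≠ j₂) : IsReducible S ε x y i₀ i₁ i₂ j₀ j₁ j₂ := by
  have hy : y ∈ S := by simpa [hmid] using h.mem (x, i₀) hx
  have hmid' : ε (y, j₀) = (x, i₀) := by rw [← hmid, h.inv _ hx]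
  have hX : ∀ i, i₀ ≠ i → (ε (x, i)).1 ≠ x ∧ (ε (x, i)).1 ≠ y := fun i hi => by
    refine ⟨h.fst_ne (d := (x, i)) hx, ?_⟩
    have := h.no_double_edge hS (c := (x, i)) (d := (x, i₀)) hx (by simp [hi.symm]) rfl
    rwa [hmid] at this
  have hY : ∀ j, j₀ ≠ j → (ε (y, j)).1 ≠ x ∧ (ε (y, j)).1 ≠ y := fun j hj => by
    refine ⟨?_, h.fst_ne (d := (y, j)) hy⟩
    have := h.no_double_edge hS (c := (y, j)) (d := (y, j₀)) hy (by simp [hj.symm]) rfl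
    rwa [hmid'] at this
  refine ⟨hx, hy, ?_, hi, hj, hmid, hX _ hi.1, hX _ hi.2.1, hY _ hj.1, hY _ hj.2.1⟩
  have := h.fst_ne (d := (x, i₀)) hx
  rw [hmid] at this
  exact this.symm

theorem Robust.far_ends_ne (h : Robust S ε) (hS : 5 ≤ #S) (hx : x ∈ S)
    (hmid : ε (x, i₀) = (y, j₀)) {i : Fin 3} (hi : i₀ ≠ i) (j : Fin 3) :
    (ε (x, i)).1 ≠ (ε (y, j)).1 :=
  (h.no_triangle hS (b := (x, i₀)) (c := (x, i)) (d := (y, j)) hx (by simp [hi.symm]) rfl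
    (by rw [hmid])).symm

theorem indicator_add_le_one (T : Finset V) (u v : V) :
    ((if u ∈ X ∧ v ∈ X then 1 else 0) + if u ∈ T \ X ∧ v ∈ T \ X then 1 else 0) ≤ 1 := by
  by_cases hu : u ∈ X <;> by_cases hv : v ∈ X <;> simp [hu, hv]
  all_goals split_ifs <;> simp

theorem Robust.quellable_of_reducible (ih : ∀ T : Finset V, #T < #S → AllQuellable T)
    (h : Robust S ε) (hS : 5 ≤ #S) (hL : IsSparse S ε L)
    (r : IsReducible S ε x y i₀ i₁ i₂ j₀ j₁ j₂) (he : e.1 ∈ S \ {x, y})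
    (hw : (ε (x, i₂)).1 = e.1) (hne : ε (x, i₂) ≠ e)
    (hcolor : ∀ φ : V → Bool,
      (∃ cx cy, (L (x, i₀) → cx ≠ cy) ∧ (L (x, i₂) → cx ≠ φ (ε (x, i₂)).1) ∧
        (L (y, j₂) → cy ≠ φ (ε (y, j₂)).1)) ∧
      ∃ cx cy, (L (x, i₁) → cx ≠ φ (ε (x, i₁)).1) ∧ (L (x, i₂) → cx ≠ φ (ε (x, i₂)).1) ∧
        (L (y, j₁) → cy ≠ φ (ε (y, j₁)).1) ∧ (L (y, j₂) → cy ≠ φ (ε (y, j₂)).1)) :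
    Quellable S ε L e := by
  have hsub : {x, y} ⊆ S := by
    have := r.left_mem
    have := r.right_mem
    grind
  have hcard : #(S \ {x, y}) = #S - 2 := by
    rw [card_sdiff_of_subset hsub, card_pair r.ne]
  have hfar := fun i hi => h.far_ends_ne hS r.left_mem r.mid (i := i) hi
  have hb : Bridgeless (S \ {x, y}) (reduce ε x y i₁ i₂ j₁ j₂) := by
    refine h.bridgeless_of_card_cut (r.isCubic h.toIsCubic) sdiff_subset ?_ _
      (fun X hX => r.card_cut h.toIsCubic hX) (fun X _ hN => ?_) fun X _ => ?_
    · rw [Finset.sdiff_sdiff_eq_self hsub, card_pair r.ne]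
    · by_contra hlt
      refine hN ?_
      rw [if_neg, if_neg]
      · exact fun h' => hlt (one_lt_card.mpr ⟨_, h'.1, _, h'.2, hfar _ r.left_ne.2.1 _⟩)
      · exact fun h' => hlt (one_lt_card.mpr ⟨_, h'.1, _, h'.2, hfar _ r.left_ne.1 _⟩)
    · have h₁ := indicator_add_le_one (X := X) (S \ {x, y}) (ε (x, i₁)).1 (ε (y, j₁)).1
      have h₂ := indicator_add_le_one (X := X) (S \ {x, y}) (ε (x, i₂)).1 (ε (y, j₂)).1
      omega
  obtain ⟨μ, φ, hμ, q⟩ := ih _ (by omega) _ _ e (r.isCubic h.toIsCubic) hb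
    (r.isSparse h.toIsCubic hL) he
  have h₂ : μ (ε (x, i₂)).1 ≠ (ε (x, i₂)).2 := fun hm =>
    hne (Prod.ext hw (by rw [← hm, hw, hμ]))
  have he' := mem_sdiff_pair.mp he
  obtain ⟨⟨cx, cy, hm⟩, ⟨dx, dy, hf⟩⟩ := hcolor φ
  by_cases h₁ : μ (ε (x, i₁)).1 = (ε (x, i₁)).2
  · obtain ⟨μ', φ', hμ', -, -, q'⟩ := r.exists_quells h.toIsCubic hL q h₂ cx cy (fun _ => hm)
      fun h' => absurd h₁ h'
    exact ⟨μ', φ', (hμ' _ he'.2.1 he'.2.2).1.trans hμ, q'⟩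
  · obtain ⟨μ', φ', hμ', -, -, q'⟩ := r.exists_quells h.toIsCubic hL q h₂ dx dy
      (fun h' => absurd h' h₁) fun _ => hf
    exact ⟨μ', φ', (hμ' _ he'.2.1 he'.2.2).1.trans hμ, q'⟩

end Step

theorem Robust.quellable_of_neighbor_mem (ih : ∀ T : Finset V, #T < #S → AllQuellable T)
    (h : Robust S ε) (hS : 5 ≤ #S) (hL : IsSparse S ε L)
    (hL2 : ∀ d, d.1 ∈ S → L d → ∃ j ≠ d.2, L (d.1, j)) (he : e.1 ∈ S) {d : V × Fin 3}
    (hd : d.1 = e.1) (hde : d ≠ e) {i : Fin 3} (hi : L ((ε d).1, i)) : Quellable S ε L e := by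
  have hdS : d.1 ∈ S := hd ▸ he
  obtain ⟨⟨x, i₂⟩, hx⟩ : ∃ c, c = ε d := ⟨_, rfl⟩
  rw [← hx] at hi
  have hxS : x ∈ S := by simpa [← hx] using h.mem d hdS
  have hback : ε (x, i₂) = d := by rw [hx, h.inv d hdS]
  obtain ⟨i₀, h₀₂, hL₀⟩ : ∃ i₀, i₀ ≠ i₂ ∧ L (x, i₀) := by
    by_cases h' : i = i₂
    · obtain ⟨j, hj, hj'⟩ := hL2 (x, i) hxS hi
      exact ⟨j, h' ▸ hj, hj'⟩
    · exact ⟨i, h', hi⟩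
  obtain ⟨i₁, h₀₁, h₂₁⟩ := exists_third h₀₂
  obtain ⟨⟨y, j₀⟩, hy⟩ : ∃ c, c = ε (x, i₀) := ⟨_, rfl⟩
  have hyS : y ∈ S := by simpa [← hy] using h.mem (x, i₀) hxS
  have hLy : L (y, j₀) := hy ▸ hL.symm _ hxS hL₀
  obtain ⟨j₂, hj₂⟩ := hL.exists_not y hyS
  have h₀₂' : j₀ ≠ j₂ := by rintro rfl; exact hj₂ hLy
  obtain ⟨j₁, h₀₁', h₂₁'⟩ := exists_third h₀₂'
  have r := h.isReducible hS hxS hy.symm ⟨h₀₁, h₀₂, h₂₁.symm⟩ ⟨h₀₁', h₀₂', h₂₁'.symm⟩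
  refine h.quellable_of_reducible ih hS hL r ?_ (by rw [hback, hd]) (by rwa [hback])
    fun φ => ⟨?_, ?_⟩
  · have := r.left₂
    rw [hback, hd] at this
    exact mem_sdiff_pair.mpr ⟨he, this⟩
  · refine ⟨!φ (ε (x, i₂)).1, φ (ε (x, i₂)).1, fun _ => by simp, fun _ => by simp,
      fun h' => absurd h' hj₂⟩
  · have hor : ¬ L (x, i₁) ∨ ¬ L (x, i₂) := by
      obtain ⟨k, hk⟩ := hL.exists_not x hxS
      obtain rfl | rfl | rfl := eq_or_eq_or_eq r.left_ne k
      · exact absurd hL₀ hk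
      · exact .inl hk
      · exact .inr hk
    obtain h' | h' := hor
    · exact ⟨!φ (ε (x, i₂)).1, !φ (ε (y, j₁)).1, fun hl => absurd hl h', fun _ => by simp,
        fun _ => by simp, fun hl => absurd hl hj₂⟩
    · exact ⟨!φ (ε (x, i₁)).1, !φ (ε (y, j₁)).1, fun _ => by simp, fun hl => absurd hl h',
        fun _ => by simp, fun hl => absurd hl hj₂⟩

theorem Quellable.of_opposite (h : IsCubic S ε) (he : e.1 ∈ S) (q : Quellable S ε L (ε e)) :
    Quellable S ε L e := by
  obtain ⟨μ, φ, hμ, q⟩ := q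
  exact ⟨μ, φ, by simpa [h.inv e he] using q.symm (ε e) (h.mem e he) hμ, q⟩

theorem Robust.quellable_of_double_step (ih : ∀ T : Finset V, #T < #S → AllQuellable T)
    (h : Robust S ε) (hS : 5 ≤ #S) (hL : IsSparse S ε L)
    (hL2 : ∀ d, d.1 ∈ S → L d → ∃ j ≠ d.2, L (d.1, j)) {x y : V} {i₀ i₁ i₂ j₀ j₁ j₂ : Fin 3}
    (r : IsReducible S ε x y i₀ i₁ i₂ j₀ j₁ j₂) (he : e.1 ∈ S \ {x, y})
    (hw : (ε (x, i₂)).1 = e.1) (hne : ε (x, i₂) ≠ e) (hx : ∀ i, ¬ L (x, i))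
    (hLw : ∀ i, ¬ L (e.1, i)) (hnbr : ∀ d : V × Fin 3, d.1 = e.1 → ∀ i, ¬ L ((ε d).1, i))
    (hy₁ : L (y, j₁)) (hy₂ : L (y, j₂)) : Quellable S ε L e := by
  have hxS := r.left_mem
  have hyS := r.right_mem
  have hmid' : ε (y, j₀) = (x, i₀) := by rw [← r.mid, h.inv _ hxS]
  obtain ⟨⟨p, k⟩, hp⟩ : ∃ c, c = ε (y, j₁) := ⟨_, rfl⟩
  have hLp : L (p, k) := hp ▸ hL.symm _ hyS hy₁
  obtain ⟨⟨q, k₂⟩, hq⟩ : ∃ c, c = ε (y, j₂) := ⟨_, rfl⟩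
  have hqS : q ∈ S := by simpa [← hq] using h.mem (y, j₂) hyS
  have hLq : L (q, k₂) := hq ▸ hL.symm _ hyS hy₂
  have hqy : ε (q, k₂) = (y, j₂) := by rw [hq, h.inv _ hyS]
  obtain ⟨k₀, hk₀₂, hLk₀⟩ := hL2 (q, k₂) hqS hLq
  dsimp only at hk₀₂ hLk₀
  obtain ⟨k₁, hk₀₁, hk₂₁⟩ := exists_third hk₀₂
  have hLk₁ : ¬ L (q, k₁) := by
    obtain ⟨m, hm⟩ := hL.exists_not q hqS
    obtain rfl | rfl | rfl := eq_or_eq_or_eq ⟨hk₀₁, hk₀₂, hk₂₁.symm⟩ m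
    exacts [absurd hLk₀ hm, hm, absurd hLq hm]
  obtain ⟨⟨c, l₀⟩, hc⟩ : ∃ d, d = ε (q, k₀) := ⟨_, rfl⟩
  have hcS : c ∈ S := by simpa [← hc] using h.mem (q, k₀) hqS
  have hLc : L (c, l₀) := hc ▸ hL.symm _ hqS hLk₀
  obtain ⟨l₁, hl₁, hLl₁⟩ := hL2 (c, l₀) hcS hLc
  dsimp only at hl₁ hLl₁
  obtain ⟨l₂, hl₁₂, hl₀₂⟩ := exists_third hl₁
  have hLl₂ : ¬ L (c, l₂) := by
    obtain ⟨m, hm⟩ := hL.exists_not c hcS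
    obtain rfl | rfl | rfl := eq_or_eq_or_eq ⟨hl₁, hl₁₂, hl₀₂⟩ m
    exacts [absurd hLl₁ hm, absurd hLc hm, hm]
  have t := h.isReducible hS hqS hc.symm ⟨hk₀₁, hk₀₂, hk₂₁.symm⟩ ⟨hl₁.symm, hl₀₂, hl₁₂⟩
  have s := h.isReducible hS hyS (i₁ := j₁) (i₂ := j₀) hq.symm
    ⟨r.right_ne.2.2.symm, r.right_ne.2.1.symm, r.right_ne.1.symm⟩ ⟨hk₀₂.symm, hk₂₁, hk₀₁⟩
  have farxy : ∀ i, i₀ ≠ i → ∀ j, (ε (x, i)).1 ≠ (ε (y, j)).1 := fun i hi =>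
    h.far_ends_ne hS hxS r.mid hi
  have farqc : ∀ i, k₀ ≠ i → ∀ j, (ε (q, i)).1 ≠ (ε (c, j)).1 := fun i hi =>
    h.far_ends_ne hS hqS hc.symm hi
  have farqy : ∀ i, k₂ ≠ i → ∀ j, (ε (q, i)).1 ≠ (ε (y, j)).1 := fun i hi =>
    h.far_ends_ne hS hqS hqy hi
  have hqx : q ≠ x := by rintro rfl; exact hx _ hLq
  have hqy' : q ≠ y := fun h' => s.ne h'.symm
  have hcx : c ≠ x := by rintro rfl; exact hx _ hLc
  have hcy : c ≠ y := by have := s.right₁.1; rwa [← hc] at this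
  have hqc : q ≠ c := t.ne
  have hwq : e.1 ≠ q := fun h' => hLw _ (h' ▸ hLq)
  have hwc : e.1 ≠ c := fun h' => hLw _ (h' ▸ hLc)
  have hpq : p ≠ q := by have := s.left₁.2; rwa [← hp] at this
  have hpc : p ≠ c := by have := farqy k₀ hk₀₂.symm j₁; rwa [← hc, ← hp, ne_comm] at this
  have hpw : p ≠ e.1 := fun h' => hLw _ (h' ▸ hLp)
  have hcub := r.isCubic h.toIsCubic
  have hsp := r.isSparse h.toIsCubic hL
  have hqk₁ : (ε (q, k₁)).1 ≠ x := by
    have := farqy k₁ hk₂₁ j₀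
    rwa [hmid'] at this
  have hcl₁ : (ε (c, l₁)).1 ≠ x := fun h' => hx (ε (c, l₁)).2 (by
    have := hL.symm (c, l₁) hcS hLl₁
    rwa [← h'])
  have hcl₁' : (ε (c, l₁)).1 ≠ y := by
    have := farqc k₂ hk₀₂ l₁
    rw [hqy] at this
    exact this.symm
  have E₀ : reduce ε x y i₁ i₂ j₁ j₂ (q, k₀) = (c, l₀) := by
    rw [r.reduce_of_ne h.toIsCubic, hc] <;> rwa [← hc]
  have E₁ := r.reduce_of_ne h.toIsCubic hqk₁ s.right₂.1
  have E₂ : reduce ε x y i₁ i₂ j₁ j₂ (q, k₂) = ε (x, i₂) := by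
    rw [hq, (r.reduce_apply h.toIsCubic).2.2.2]
  have E₃ := r.reduce_of_ne h.toIsCubic hcl₁ hcl₁'
  obtain ⟨hBq, hBc, hBe⟩ : (reduce ε x y i₁ i₂ j₁ j₂ (c, l₂)).1 ≠ q ∧
      (reduce ε x y i₁ i₂ j₁ j₂ (c, l₂)).1 ≠ c ∧
      (reduce ε x y i₁ i₂ j₁ j₂ (c, l₂)).1 ≠ e.1 := by
    obtain ⟨n₁, n₂⟩ | h' | h' | h' | h' := r.cases h.toIsCubic (d := (c, l₂))
      (mem_sdiff_pair.mpr ⟨hcS, hcx, hcy⟩)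
    · rw [r.reduce_of_ne h.toIsCubic n₁ n₂]
      refine ⟨t.right₂.1, t.right₂.2, fun h' => hnbr _ h' l₀ ?_⟩
      rwa [h.inv _ hcS]
    · rw [h', (r.reduce_apply h.toIsCubic).1, ← hp]
      exact ⟨hpq, hpc, hpw⟩
    · exact absurd (hw ▸ congrArg Prod.fst h').symm hwc
    · exact absurd (congrArg Prod.fst (h'.trans hp.symm)).symm hpc
    · exact absurd (congrArg Prod.fst (h'.trans hq.symm)).symm hqc
  obtain ⟨ε', hε'⟩ : ∃ ε', ε' = reduce ε x y i₁ i₂ j₁ j₂ := ⟨_, rfl⟩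
  rw [← hε'] at hcub hsp E₀ E₁ E₂ E₃ hBq hBc hBe
  have t' : IsReducible (S \ {x, y}) ε' q c k₀ k₁ k₂ l₀ l₁ l₂ :=
    ⟨mem_sdiff_pair.mpr ⟨hqS, hqx, hqy'⟩, mem_sdiff_pair.mpr ⟨hcS, hcx, hcy⟩, hqc, t.left_ne,
      t.right_ne, E₀, E₁ ▸ t.left₁, by rw [E₂, hw]; exact ⟨hwq, hwc⟩, E₃ ▸ t.right₁,
      hBq, hBc⟩
  have hcard : #(S \ {x, y}) = #S - 2 := by
    rw [card_sdiff_of_subset (by grind), card_pair r.ne]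
  have hsub : (S \ {x, y}) \ {q, c} ⊆ S := sdiff_subset.trans sdiff_subset
  have hlt : #((S \ {x, y}) \ {q, c}) < #S :=
    (card_le_card sdiff_subset).trans_lt (by omega)
  have hb : Bridgeless ((S \ {x, y}) \ {q, c}) (reduce ε' q c k₁ k₂ l₁ l₂) := by
    refine h.bridgeless_of_card_cut (t'.isCubic hcub) hsub ?_
      (fun X => (if (ε (x, i₁)).1 ∈ X ∧ (ε (y, j₁)).1 ∈ X then 1 else 0) +
        ((if (ε' (q, k₁)).1 ∈ X ∧ (ε' (c, l₁)).1 ∈ X then 1 else 0) +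
        if (ε' (q, k₂)).1 ∈ X ∧ (ε' (c, l₂)).1 ∈ X then 1 else 0))
      (fun X hX => ?_) (fun X _ hN => ?_) fun X _ => ?_
    · rw [← card_pair r.ne]
      exact card_le_card (by grind)
    · have hqX : q ∉ X := fun h' => (mem_sdiff_pair.mp (hX h')).2.1 rfl
      rw [r.card_cut h.toIsCubic (hX.trans sdiff_subset), ← hε', t'.card_cut hcub hX, ← hq]
      simp only [hqX, and_false, if_false]
      ring
    · by_contra hlt
      refine hN ?_
      rw [if_neg, if_neg, if_neg]
      · rw [E₂, hw]
        exact fun h' => hlt (one_lt_card.mpr ⟨_, h'.1, _, h'.2, hBe.symm⟩)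
      · rw [E₁, E₃]
        exact fun h' => hlt (one_lt_card.mpr ⟨_, h'.1, _, h'.2, farqc _ hk₀₁ _⟩)
      · exact fun h' => hlt (one_lt_card.mpr ⟨_, h'.1, _, h'.2, farxy _ r.left_ne.1 _⟩)
    · have h₁ := indicator_add_le_one (X := X) ((S \ {x, y}) \ {q, c})
        (ε (x, i₁)).1 (ε (y, j₁)).1
      have h₂ := indicator_add_le_one (X := X) ((S \ {x, y}) \ {q, c})
        (ε' (q, k₁)).1 (ε' (c, l₁)).1
      have h₃ := indicator_add_le_one (X := X) ((S \ {x, y}) \ {q, c})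
        (ε' (q, k₂)).1 (ε' (c, l₂)).1
      omega
  obtain ⟨μ, φ, hμ, Q⟩ := ih _ hlt _ _ e (t'.isCubic hcub) hb (t'.isSparse hcub hsp)
    (mem_sdiff_pair.mpr ⟨he, hwq, hwc⟩)
  have hback : ∀ μ : V → Fin 3, μ e.1 = e.2 → μ (ε (x, i₂)).1 ≠ (ε (x, i₂)).2 := fun μ hμ hm =>
    hne (Prod.ext hw (by rw [← hm, hw, hμ]))
  obtain ⟨μ', φ', hφ', hφq, Q'⟩ : ∃ μ' φ', (∀ v, v ≠ q → v ≠ c → μ' v = μ v ∧ φ' v = φ v) ∧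
      φ' q = φ p ∧ Quells (S \ {x, y}) ε' (fun d => L d ∧ (ε d).1 ≠ x ∧ (ε d).1 ≠ y) μ' φ' := by
    have hqk₂ : ¬ (L (q, k₂) ∧ (ε (q, k₂)).1 ≠ x ∧ (ε (q, k₂)).1 ≠ y) := fun hl =>
      hl.2.2 (by rw [hqy])
    have h₂ : μ (ε' (q, k₂)).1 ≠ (ε' (q, k₂)).2 := by rw [E₂]; exact hback μ hμ
    by_cases hm : μ (ε' (q, k₁)).1 = (ε' (q, k₁)).2
    · obtain ⟨μ', φ', hφ', hφq, -, Q'⟩ := t'.exists_quells hcub hsp Q h₂ (φ p) (!φ p)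
        (fun _ => ⟨by simp, fun hl => absurd hl hqk₂, fun hl => absurd hl.1 hLl₂⟩)
        (fun h' => absurd hm h')
      exact ⟨μ', φ', hφ', hφq, Q'⟩
    · obtain ⟨μ', φ', hφ', hφq, -, Q'⟩ := t'.exists_quells hcub hsp Q h₂ (φ p)
        (!φ (ε' (c, l₁)).1) (fun h' => absurd h' hm)
        (fun _ => ⟨fun hl => absurd hl.1 hLk₁, fun hl => absurd hl hqk₂, by simp,
          fun hl => absurd hl.1 hLl₂⟩)
      exact ⟨μ', φ', hφ', hφq, Q'⟩
  have hμ' : μ' e.1 = e.2 := (hφ' _ hwq hwc).1.trans hμ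
  have hφp : φ' p = φ' q := (hφ' _ hpq hpc).2.trans hφq.symm
  obtain ⟨μ'', φ'', hφ'', -, -, Q''⟩ := r.exists_quells h.toIsCubic hL (hε' ▸ Q') (hback μ' hμ')
    false (!φ' q)
    (fun _ => ⟨fun hl => absurd hl (hx _), fun hl => absurd hl (hx _), by simp [← hq]⟩)
    (fun _ => ⟨fun hl => absurd hl (hx _), fun hl => absurd hl (hx _), by simp [← hp, hφp],
      by simp [← hq]⟩)
  have he' := mem_sdiff_pair.mp he
  exact ⟨μ'', φ'', (hφ'' _ he'.2.1 he'.2.2).1.trans hμ', Q''⟩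

theorem Robust.quellable_of_not_mem (ih : ∀ T : Finset V, #T < #S → AllQuellable T)
    (h : Robust S ε) (hS : 5 ≤ #S) (hL : IsSparse S ε L)
    (hL2 : ∀ d, d.1 ∈ S → L d → ∃ j ≠ d.2, L (d.1, j)) (he : e.1 ∈ S) (hLe : ¬ L e) :
    Quellable S ε L e := by
  have hεS := h.mem e he
  have hinv := h.inv e he
  by_cases H : ∃ d : V × Fin 3, d.1 = e.1 ∧ d ≠ e ∧ ∃ i, L ((ε d).1, i)
  · obtain ⟨d, hd, hde, i, hi⟩ := H
    exact h.quellable_of_neighbor_mem ih hS hL hL2 he hd hde hi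
  by_cases H' : ∃ d : V × Fin 3, d.1 = (ε e).1 ∧ d ≠ ε e ∧ ∃ i, L ((ε d).1, i)
  · obtain ⟨d, hd, hde, i, hi⟩ := H'
    exact .of_opposite h.toIsCubic he (h.quellable_of_neighbor_mem ih hS hL hL2 hεS hd hde hi)
  push Not at H H'
  have hLw : ∀ i, ¬ L (e.1, i) := fun i hi =>
    H (e.1, i) rfl (fun h' => hLe (h' ▸ hi)) _ (hL.symm _ he hi)
  have hLz : ∀ i, ¬ L ((ε e).1, i) := fun i hi => by
    refine H' ((ε e).1, i) rfl (fun h' => hLe ?_) _ (hL.symm _ hεS hi)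
    rw [h'] at hi
    simpa [hinv] using hL.symm _ hεS hi
  have hnbr : ∀ d : V × Fin 3, d.1 = e.1 → ∀ i, ¬ L ((ε d).1, i) := fun d hd => by
    obtain rfl | hde := eq_or_ne d e
    exacts [hLz, H d hd hde]
  obtain ⟨k, hk⟩ : ∃ k, e.2 ≠ k := (exists_ne e.2).imp fun _ => Ne.symm
  obtain ⟨⟨x, i₂⟩, hx⟩ : ∃ c, c = ε (e.1, k) := ⟨_, rfl⟩
  have hxS : x ∈ S := by simpa [← hx] using h.mem (e.1, k) he
  have hback : ε (x, i₂) = (e.1, k) := by rw [hx, h.inv (e.1, k) he]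
  have hLx : ∀ i, ¬ L (x, i) := by simpa [← hx] using hnbr (e.1, k) rfl
  obtain ⟨i₀, h₀₂⟩ := exists_ne i₂
  obtain ⟨i₁, h₀₁, h₂₁⟩ := exists_third h₀₂
  obtain ⟨⟨y, j₀⟩, hy⟩ : ∃ c, c = ε (x, i₀) := ⟨_, rfl⟩
  have hyS : y ∈ S := by simpa [← hy] using h.mem (x, i₀) hxS
  have hLy₀ : ¬ L (y, j₀) := fun hl => hLx i₀ (by
    have := hL.symm _ hyS hl
    rwa [hy, h.inv _ hxS] at this)
  have hw : (ε (x, i₂)).1 = e.1 := by rw [hback]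
  have hne : ε (x, i₂) ≠ e := by
    rw [hback]
    exact fun h' => hk (congrArg Prod.snd h').symm
  have hmem : ∀ j₁ j₂, IsReducible S ε x y i₀ i₁ i₂ j₀ j₁ j₂ → e.1 ∈ S \ {x, y} :=
    fun _ _ r => mem_sdiff_pair.mpr ⟨he, hw ▸ r.left₂⟩
  by_cases hy' : ∃ j, L (y, j)
  · obtain ⟨j₁, hj₁⟩ := hy'
    obtain ⟨j₂, h₂₁', hj₂⟩ := hL2 _ hyS hj₁
    have r := h.isReducible hS hxS hy.symm ⟨h₀₁, h₀₂, h₂₁.symm⟩ (j₁ := j₁) (j₂ := j₂)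
      ⟨by rintro rfl; exact hLy₀ hj₁, by rintro rfl; exact hLy₀ hj₂, h₂₁'.symm⟩
    exact h.quellable_of_double_step ih hS hL hL2 r (hmem _ _ r) hw hne hLx hLw hnbr hj₁ hj₂
  · push Not at hy'
    obtain ⟨j₁, h₀₁'⟩ := exists_ne j₀
    obtain ⟨j₂, h₁₂', h₀₂'⟩ := exists_third h₀₁'
    have r := h.isReducible hS hxS hy.symm ⟨h₀₁, h₀₂, h₂₁.symm⟩ ⟨h₀₁'.symm, h₀₂', h₁₂'⟩
    exact h.quellable_of_reducible ih hS hL r (hmem _ _ r) hw hne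
      fun φ => ⟨⟨false, false, by simp [hLx, hy']⟩, false, false, by simp [hLx, hy']⟩

theorem allQuellable (S : Finset V) : AllQuellable S := by
  induction hn : #S using Nat.strong_induction_on generalizing S with
  | _ n IH =>
  subst hn
  have ih : ∀ T : Finset V, #T < #S → AllQuellable T := fun T hT => IH _ hT T rfl
  intro ε L e h hb hL he
  refine quellable_of_forall_reduced h hb he (fun L hL hLe hL2 => ?_) hL
  by_cases hr : ∀ X ⊆ S, 2 ≤ #X → 2 ≤ #(S \ X) → 4 ≤ #(cut ε X)
  · have r : Robust S ε := ⟨h, hb, hr⟩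
    by_cases hS : 5 ≤ #S
    · exact r.quellable_of_not_mem ih hS hL hL2 he hLe
    have := h.even_card
    obtain h' | h' : #S = 2 ∨ #S = 4 := by grind
    · exact r.quellable_of_card_eq_two he h'
    · exact r.quellable_of_card_eq_four he h'
  · push Not at hr
    obtain ⟨X, hX, heX, hX₂, hX₂', hcut⟩ : ∃ X ⊆ S, e.1 ∈ X ∧ 2 ≤ #X ∧ 2 ≤ #(S \ X) ∧
        #(cut ε X) < 4 := by
      obtain ⟨X, hX, h₁, h₂, h₃⟩ := hr
      by_cases heX : e.1 ∈ X
      · exact ⟨X, hX, heX, h₁, h₂, h₃⟩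
      · refine ⟨S \ X, sdiff_subset, by simp [he, heX], h₂, ?_, ?_⟩
        · rwa [Finset.sdiff_sdiff_eq_self hX]
        · rwa [h.card_cut_sdiff hX]
    have h₁ := hb X hX
    obtain h' | h' | h' : #(cut ε X) = 0 ∨ #(cut ε X) = 2 ∨ #(cut ε X) = 3 := by omega
    · exact quellable_of_cut_eq_empty ih h hb hL hX heX (card_pos.mp (by omega))
        (card_eq_zero.mp h')
    · exact quellable_of_card_cut_eq_two ih h hb hL hL2 hX heX h'
    · exact quellable_of_card_cut_eq_three ih h hb hL hL2 hX heX hX₂ hX₂' h'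

theorem exists_neighbor_enumeration {V : Type*} (G : SimpleGraph V)
    (hG : ∀ v : V, (G.neighborSet v).ncard = 3) :
    ∃ n : V → Fin 3 → V, ∀ v, Function.Injective (n v) ∧ ∀ u, G.Adj v u ↔ ∃ i, n v i = u := by
  have (v : V) : ∃ n : Fin 3 → V, Function.Injective n ∧ ∀ u, G.Adj v u ↔ ∃ i, n i = u := by
    have hfin : Finite (G.neighborSet v) := Set.finite_of_ncard_pos (by simp [hG])
    have f : G.neighborSet v ≃ Fin 3 := Finite.equivFinOfCardEq (by simpa using hG v)
    refine ⟨fun i => f.symm i, Subtype.val_injective.comp f.symm.injective, fun u =>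
      ⟨fun h => ⟨f ⟨u, h⟩, by simp⟩, ?_⟩⟩
    rintro ⟨i, rfl⟩
    exact (f.symm i).2
  choose n hn using this
  exact ⟨n, hn⟩

theorem isBridge_of_cut_eq_singleton {G : SimpleGraph V} {n : V → Fin 3 → V}
    (hadj : ∀ v u, G.Adj v u ↔ ∃ i, n v i = u) (hε : ∀ d, (ε d).1 = n d.1 d.2)
    {d : V × Fin 3} (hd : cut ε X = {d}) : G.IsBridge s(d.1, (ε d).1) := by
  have hdX := mem_cut.mp (hd ▸ mem_singleton_self d)
  rw [SimpleGraph.isBridge_iff]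
  rintro ⟨p⟩
  have key : ∀ {v w : V}, (G.deleteEdges {s(d.1, (ε d).1)}).Walk v w → v ∈ X → w ∈ X := by
    intro v w p
    induction p with
    | nil => exact id
    | @cons a b _ h _ ihp =>
      intro hv
      refine ihp (by_contra fun hb => ?_)
      rw [SimpleGraph.deleteEdges_adj] at h
      obtain ⟨i, rfl⟩ := (hadj a b).mp h.1
      have hc : (a, i) ∈ cut ε X := mem_cut.mpr ⟨hv, by rwa [hε]⟩
      rw [hd, mem_singleton] at hc
      subst hc
      exact h.2 (by simp [hε])
  exact hdX.2 (key p hdX.1)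

end DartGraph

/-- For every bridgeless cubic graph `G` and every parity subgraph (join) `J` of `G`
(a spanning subgraph with all degrees odd), there is a perfect matching `M` of `G`
such that deleting the edges of `J` and `M` leaves a bipartite graph. -/
theorem quelling_pair_of_parity_subgraph {V : Type*} [Fintype V] (G : SimpleGraph V)
    (hcubic : ∀ v : V, (G.neighborSet v).ncard = 3)
    (hbridgeless : ∀ e : Sym2 V, ¬ G.IsBridge e)
    (J : G.Subgraph) (hJspan : J.IsSpanning)
    (hJodd : ∀ v : V, Odd ((J.neighborSet v).ncard)) :
    ∃ M : G.Subgraph, M.IsPerfectMatching ∧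
      (G.deleteEdges (J.edgeSet ∪ M.edgeSet)).Colorable 2 := by
  classical
  obtain ⟨n, hn⟩ := DartGraph.exists_neighbor_enumeration G hcubic
  have hinj (v : V) : Function.Injective (n v) := (hn v).1
  have hadj (v u : V) : G.Adj v u ↔ ∃ i, n v i = u := (hn v).2 u
  have hadj' (v : V) (i : Fin 3) : G.Adj v (n v i) := (hadj _ _).mpr ⟨i, rfl⟩
  have hback (v : V) (i : Fin 3) : ∃ j, n (n v i) j = v := (hadj _ _).mp (hadj' v i).symm
  choose g hg using hback
  obtain ⟨ε, hε⟩ : ∃ ε : V × Fin 3 → V × Fin 3, ∀ d, ε d = (n d.1 d.2, g d.1 d.2) :=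
    ⟨_, fun _ => rfl⟩
  have hc : DartGraph.IsCubic Finset.univ ε := by
    refine ⟨fun _ _ => Finset.mem_univ _, fun ⟨v, i⟩ _ => ?_, fun ⟨v, i⟩ _ h => ?_⟩
    · have h := hg (n v i) (g v i)
      rw [hg v i] at h
      simp only [hε]
      exact Prod.ext (hg v i) (hinj _ h)
    · rw [hε] at h
      exact (hadj' v i).ne (congrArg Prod.fst h).symm
  have hb : DartGraph.Bridgeless Finset.univ ε := fun X _ h => by
    obtain ⟨d, hd⟩ := Finset.card_eq_one.mp h
    exact hbridgeless _ (DartGraph.isBridge_of_cut_eq_singleton hadj (fun d => by rw [hε]) hd)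
  have hL : DartGraph.IsSparse Finset.univ ε fun d => ¬ J.Adj d.1 (n d.1 d.2) := by
    refine ⟨fun ⟨v, i⟩ _ h => ?_, fun v _ => ?_⟩
    · simpa [hε, hg, J.adj_comm] using h
    · obtain ⟨u, hu⟩ := Set.nonempty_of_ncard_ne_zero (hJodd v).pos.ne'
      obtain ⟨i, rfl⟩ := (hadj _ _).mp hu.adj_sub
      exact ⟨i, not_not.mpr hu⟩
  obtain ⟨μ, φ, hsymm, hcolor⟩ : ∃ μ φ, DartGraph.Quells Finset.univ ε
      (fun d => ¬ J.Adj d.1 (n d.1 d.2)) μ φ := by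
    cases isEmpty_or_nonempty V with
    | inl _ => exact ⟨fun _ => 0, fun _ => false, fun d => isEmptyElim d.1, fun d => isEmptyElim d.1⟩
    | inr _ =>
      obtain ⟨μ, φ, -, q⟩ := DartGraph.allQuellable Finset.univ ε _ (Classical.arbitrary V, 0)
        hc hb hL (Finset.mem_univ _)
      exact ⟨μ, φ, q⟩
  have hμ (v : V) : n (n v (μ v)) (μ (n v (μ v))) = v := by
    have := hsymm (v, μ v) (Finset.mem_univ _) rfl
    simp only [hε] at this
    rw [this, hg]
  refine ⟨⟨Set.univ, fun v u => n v (μ v) = u, ?_, fun _ => trivial, ⟨?_⟩⟩, ?_, ?_⟩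
  · rintro v _ rfl
    exact hadj' v _
  · rintro v _ rfl
    exact hμ v
  · rw [SimpleGraph.Subgraph.isPerfectMatching_iff]
    exact fun v => ⟨n v (μ v), rfl, fun _ h => Eq.symm h⟩
  · refine (SimpleGraph.Coloring.mk φ fun {v u} h => ?_).colorable
    simp only [SimpleGraph.deleteEdges_adj, Set.mem_union, SimpleGraph.Subgraph.mem_edgeSet,
      not_or] at h
    obtain ⟨h, hJ, hM⟩ := h
    obtain ⟨i, rfl⟩ := (hadj _ _).mp h
    have := hcolor (v, i) (Finset.mem_univ _) hJ fun h' => hM (h' ▸ rfl)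
    rwa [hε] at this
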